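/- arXiv:2104.06765 — 6 statements merged into one kernel-verified Lean document; each statement's English description precedes it below -/
import Mathlib

section
/- Let G1 be a locally compact second-countable unimodular topological group with Haar measure m1 whose topology is induced by a right-invariant metric ρ with compact closed balls, and suppose there are d > 0 and 0 < c1 ≤ c2 with c1·r^d ≤ m1(B(e,r)) ≤ c2·r^d for all r ∈ (0,1]. Let G2 be a locally compact second-countable unimodular topological group with Haar measure m2 admitting a compact open subgroup K with m2(K) = 1. Let Γ be a discrete subgroup of G1 × G2 which is a lattice of covolume one, with quotient Y := (G1 × G2)/Γ carrying the invariant probability measure μ. Let H : G2 → {1,2,3,…} be K-bi-invariant with compact level sets Σ(h) := H⁻¹({h}), and let L := {h : m2(Σ(h)) > 0}. Assume: (V1) there are c_a, a > 0 with m2(Σ(h)) ≥ c_a·h^a for all h ∈ L; (C) for every η > 0 there is C_η with #(L ∩ [1,T]) ≤ C_η·T^η for all T ≥ 1; (G) there are Δ ≥ 1 and T1 such that for every T ≥ T1 there is h ∈ L with T/Δ ≤ h ≤ T; (SP) there are k ∈ (0,1/2) and C_sp such that for every h ∈ L and every φ ∈ L²(Y,μ) one has ‖ m2(Σ(h))⁻¹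 ∫_{Σ(h)} φ((e,a)·y) dm2(a) − ∫_Y φ dμ ‖_{L²(Y)} ≤ C_sp·m2(Σ(h))^{−k}·‖φ‖_{L²(Y)}. Fix b with 0 < b < 2ak/d and set θ0 := ((1−k)a − bd/2)/(a − bd), which lies in (0,1). For x ∈ G1 and T ∈ ℕ define N_T(x) := #{γ = (γ1,γ2) ∈ Γ : ρ(x, γ1) ≤ H(γ2)^{−b} and H(γ2) ≤ T} and V_T := ∑_{h=1}^{T} m1(B(e, h^{−b}))·m2(Σ(h)). Then for every θ ∈ (θ0, 1) and every bounded measurable Q ⊆ G1 there is a constant C such that (∫_Q (N_T(x) − V_T)² dm1(x))^{1/2} ≤ C·V_T^{θ} for all T ≥ 1. -/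
open MeasureTheory
section aux
open scoped ENNReal Pointwise

theorem mulOp_aux {G : Type*} [Group G] [MeasurableSpace G] [MeasurableMul₂ G]
    (Γ : Subgroup G) [Countable Γ] (m : Measure G) [m.IsMulRightInvariant] 
    (F : Set G) (hF : IsFundamentalDomain Γ.op F m) (f : G → ℝ≥0∞) (hf : Measurable f) :
    ∫⁻ g, f g ∂m = ∫⁻ g in F, ∑' γ : Γ, f (g * γ) ∂m := by
  have : Countable Γ.op := Countable.of_equiv _ (Subgroup.equivOp Γ)
  rw [hF.lintegral_eq_tsum'', lintegral_tsum (fun γ => by fun_prop)]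
  rw [← (Subgroup.equivOp Γ).tsum_eq]
  rfl

noncomputable def psi {G : Type*} [Group G] (Γ : Subgroup G) (f : G → ℝ≥0∞) : G ⧸ Γ → ℝ≥0∞ :=
  Quotient.lift (fun g => ∑' γ : Γ, f (g * γ)) (by
    intro x y hxy
    have h : x⁻¹ * y ∈ Γ := QuotientGroup.leftRel_apply.1 hxy
    show ∑' γ : Γ, f (x * γ) = ∑' γ : Γ, f (y * γ)
    rw [← (Equiv.mulLeft (⟨x⁻¹ * y, h⟩ : Γ)).tsum_eq]
    refine tsum_congr fun γ => ?_
    simp [← mul_assoc])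

theorem psi_mk {G : Type*} [Group G] (Γ : Subgroup G) (f : G → ℝ≥0∞) (g : G) :
    psi Γ f (QuotientGroup.mk g) = ∑' γ : Γ, f (g * γ) := rfl

theorem measurable_mk' {G : Type*} [Group G] [MeasurableSpace G] (Γ : Subgroup G) :
    Measurable (QuotientGroup.mk : G → G ⧸ Γ) := measurable_quotient_mk''

theorem measurable_psi {G : Type*} [Group G] [MeasurableSpace G] [MeasurableMul₂ G]
    (Γ : Subgroup G) [Countable Γ] (f : G → ℝ≥0∞) (hf : Measurable f) : Measurable (psi Γ f) := by
  apply measurable_from_quotient.2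
  show Measurable (fun g => ∑' γ : Γ, f (g * γ))
  exact Measurable.tsum (fun γ => by fun_prop)

theorem unfold_aux {G : Type*} [Group G] [MeasurableSpace G] [MeasurableMul₂ G]
    (Γ : Subgroup G) [Countable Γ] (m : Measure G) [m.IsMulRightInvariant] 
    (F : Set G) (hF : IsFundamentalDomain Γ.op F m) (μ : Measure (G ⧸ Γ))
    (hμ : μ = Measure.map (QuotientGroup.mk : G → G ⧸ Γ) (m.restrict F))
    (f : G → ℝ≥0∞) (hf : Measurable f) (w : G ⧸ Γ → ℝ≥0∞) (hw : Measurable w) :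
    ∫⁻ g, f g * w (QuotientGroup.mk g) ∂m = ∫⁻ y, psi Γ f y * w y ∂μ := by
  have hmk := measurable_mk' Γ
  have hp := measurable_psi Γ f hf
  rw [hμ, lintegral_map (by fun_prop) hmk, mulOp_aux Γ m F hF _ (by fun_prop)]
  refine lintegral_congr fun g => ?_
  rw [psi_mk, ← ENNReal.tsum_mul_right]
  refine tsum_congr fun γ => ?_
  congr 2
  exact QuotientGroup.mk_mul_of_mem g γ.2

theorem fin_aux {G : Type*} [Group G] [TopologicalSpace G] [IsTopologicalGroup G] [T2Space G]
    (Γ : Subgroup G) [DiscreteTopology Γ] (C : Set G) (hC : IsCompact C) :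
    {γ : Γ | (γ : G) ∈ C}.Finite := by
  have h := Subgroup.tendsto_coe_cofinite_of_discrete Γ ⟨inferInstanceAs (DiscreteTopology Γ)⟩
  have := h hC.compl_mem_cocompact
  rw [Filter.mem_map, Filter.mem_cofinite, Set.preimage_compl, compl_compl] at this
  exact this

theorem mult_aux {G : Type*} [Group G] [TopologicalSpace G] [IsTopologicalGroup G] [T2Space G]
    (Γ : Subgroup G) [DiscreteTopology Γ] (C : Set G) (hC : IsCompact C) :
    ∃ M : ℝ≥0∞, M ≠ ⊤ ∧ ∀ y, psi Γ (C.indicator 1) y ≤ M := by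
  have hD := fin_aux Γ (C⁻¹ * C) (hC.inv.mul hC)
  refine ⟨∑' γ : Γ, ({γ : Γ | (γ : G) ∈ C⁻¹ * C}).indicator 1 γ, ?_, ?_⟩
  · rw [← tsum_subtype]
    simp only [Pi.one_apply, ENNReal.tsum_set_one]
    simpa using hD
  · intro y
    induction y using QuotientGroup.induction_on with
    | H g =>
    rw [psi_mk]
    by_cases h : ∃ γ0 : Γ, g * γ0 ∈ C
    · obtain ⟨γ0, h0⟩ := h
      rw [← (Equiv.mulLeft γ0).tsum_eq]
      refine ENNReal.tsum_le_tsum fun γ => ?_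
      by_cases h1 : g * (γ0 * γ : Γ) ∈ C
      · have : (γ : G) ∈ C⁻¹ * C := by
          refine ⟨(g * γ0)⁻¹, by simpa using h0, g * (γ0 * γ : Γ), h1, ?_⟩
          simp [mul_assoc]
        simp only [Set.indicator, Set.mem_ofPred_eq, this, if_true]
        split_ifs <;> simp
      · simp only [Subgroup.coe_mul] at h1
        simp [Set.indicator, h1]
    · push Not at h
      simp [Set.indicator, h]

theorem psi_mono {G : Type*} [Group G] (Γ : Subgroup G) {A C : Set G} (h : A ⊆ C) (y : G ⧸ Γ) :
    psi Γ (A.indicator 1) y ≤ psi Γ (C.indicator 1) y := by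
  induction y using QuotientGroup.induction_on with
  | H g =>
  rw [psi_mk, psi_mk]
  exact ENNReal.tsum_le_tsum fun γ => Set.indicator_le_indicator_of_subset h (by simp) _

theorem coset_meas {G2 : Type*} [Group G2] [MeasurableSpace G2] [MeasurableMul G2]
    (m2 : Measure G2) [m2.IsMulRightInvariant]
    (K : Subgroup G2) (hK1 : m2 (K : Set G2) = 1) (S : Set G2) 
    (hSK : ∀ u ∈ K, ∀ s ∈ S, u * s ∈ S) (t : G2) :
    m2 (S ∩ {s | s * t ∈ K}) = S⁻¹.indicator 1 t := by
  by_cases ht : t⁻¹ ∈ S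
  · have : S ∩ {s | s * t ∈ K} = (fun s => s * t) ⁻¹' (K : Set G2) := by
      ext s
      simp only [Set.mem_inter_iff, Set.mem_ofPred_eq, Set.mem_preimage, SetLike.mem_coe,
        and_iff_right_iff_imp]
      intro h
      simpa using hSK _ h _ ht
    rw [this, measure_preimage_mul_right, hK1]
    simp [Set.indicator, ht]
  · have : S ∩ {s | s * t ∈ K} = ∅ := by
      ext s
      simp only [Set.mem_inter_iff, Set.mem_ofPred_eq, Set.mem_empty_iff_false, iff_false, not_and]
      intro h1 h2
      apply ht
      simpa using hSK _ (K.inv_mem h2) _ h1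
    simp [this, Set.indicator, ht]

theorem sph_avg {G1 : Type*} [Group G1] [MeasurableSpace G1] [MeasurableMul₂ G1]
    {G2 : Type*} [Group G2] [MeasurableSpace G2] [MeasurableMul₂ G2]
    (m2 : Measure G2) [m2.IsMulRightInvariant]
    (K : Subgroup G2) (hK1 : m2 (K : Set G2) = 1) (hKm : MeasurableSet (K : Set G2))
    (Γ : Subgroup (G1 × G2)) [Countable Γ]
    (S : Set G2)
    (hSK : ∀ u ∈ K, ∀ s ∈ S, u * s ∈ S) (A : Set G1) (y : (G1 × G2) ⧸ Γ) :
    ∫⁻ s in S, psi Γ ((A ×ˢ (K : Set G2)).indicator 1) (((1 : G1), s) • y) ∂m2 =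
      psi Γ ((A ×ˢ S⁻¹).indicator 1) y := by
  induction y using QuotientGroup.induction_on with
  | H g =>
  have key : ∀ γ : Γ, ∀ s : G2, (A ×ˢ (K : Set G2)).indicator (1 : G1 × G2 → ℝ≥0∞)
      (((1 : G1), s) * g * γ) = A.indicator 1 (g.1 * (γ : G1 × G2).1) *
        ({s | s * (g.2 * (γ : G1 × G2).2) ∈ K}).indicator 1 s := by
    intro γ s
    simp only [Set.indicator, Set.mem_prod, Prod.fst_mul, Prod.snd_mul, one_mul, mul_assoc,
      SetLike.mem_coe, Set.mem_ofPred_eq, Pi.one_apply]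
    by_cases h1 : g.1 * (γ : G1 × G2).1 ∈ A <;>
      by_cases h2 : s * (g.2 * (γ : G1 × G2).2) ∈ K <;> simp [h1, h2, mul_assoc]
  have hm : ∀ t : G2, MeasurableSet {s | s * t ∈ K} := fun t =>
    (measurable_mul_const t) hKm
  have e1 : ∀ s : G2, psi Γ ((A ×ˢ (K : Set G2)).indicator 1)
      (((1 : G1), s) • (QuotientGroup.mk g : (G1 × G2) ⧸ Γ)) =
      ∑' γ : Γ, A.indicator 1 (g.1 * (γ : G1 × G2).1) *
        ({s | s * (g.2 * (γ : G1 × G2).2) ∈ K}).indicator 1 s := by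
    intro s
    simp_rw [← key]
    rfl
  simp_rw [e1]
  rw [lintegral_tsum, psi_mk]
  · refine tsum_congr fun γ => ?_
    rw [lintegral_const_mul, lintegral_indicator_one (hm _), Measure.restrict_apply (hm _),
      Set.inter_comm, coset_meas m2 K hK1 S hSK]
    · simp only [Set.indicator, Set.mem_prod, Prod.fst_mul, Prod.snd_mul, Pi.one_apply]
      split_ifs <;> simp_all
    · exact (measurable_one.indicator (hm _))
  · intro γ
    exact ((measurable_one.indicator (hm _)).const_mul _).aemeasurable

theorem psi_K {G1 : Type*} [Group G1] {G2 : Type*} [Group G2] 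
    (K : Subgroup G2) (Γ : Subgroup (G1 × G2)) (S : Set G2)
    (hSK : ∀ u ∈ K, ∀ s ∈ S, s * u ∈ S) (A : Set G1) (x : G1) (u : G2) (hu : u ∈ K) :
    psi Γ ((A ×ˢ S⁻¹).indicator 1) (QuotientGroup.mk (x, u)) =
      psi Γ ((A ×ˢ S⁻¹).indicator 1) (QuotientGroup.mk (x, 1)) := by
  rw [psi_mk, psi_mk]
  refine tsum_congr fun γ => ?_
  have : (u * (γ : G1 × G2).2)⁻¹ ∈ S ↔ ((γ : G1 × G2).2)⁻¹ ∈ S := by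
    constructor
    · intro h
      simpa using hSK _ hu _ h
    · intro h
      simpa using hSK _ (K.inv_mem hu) _ h
  have this2 : ((x, u) * (γ : G1 × G2) ∈ A ×ˢ S⁻¹) ↔ ((x, 1) * (γ : G1 × G2) ∈ A ×ˢ S⁻¹) := by
    rw [Set.mem_prod, Set.mem_prod, Set.mem_inv, Set.mem_inv, Prod.snd_mul, Prod.snd_mul, this,
      one_mul]
    rfl
  by_cases h : (x, 1) * (γ : G1 × G2) ∈ A ×ˢ S⁻¹
  · rw [Set.indicator_of_mem h, Set.indicator_of_mem (this2.2 h)]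
    rfl
  · rw [Set.indicator_of_notMem h, Set.indicator_of_notMem (fun h' => h (this2.1 h'))]

theorem eLpNorm_two_sq {α : Type*} [MeasurableSpace α] (μ : Measure α) (f : α → ℝ) :
    eLpNorm f 2 μ ^ 2 = ∫⁻ x, ‖f x‖ₑ ^ 2 ∂μ := by
  have := eLpNorm_nnreal_pow_eq_lintegral (μ := μ) (f := f) (p := 2) (by simp)
  simpa only [NNReal.coe_ofNat, ENNReal.rpow_ofNat, ENNReal.coe_ofNat] using this

theorem single
    {G1 : Type*} [Group G1] [MetricSpace G1] [IsTopologicalGroup G1]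
    [SecondCountableTopology G1] [ProperSpace G1]
    [MeasurableSpace G1] [BorelSpace G1]
    (m1 : Measure G1) [m1.IsHaarMeasure] [m1.IsMulRightInvariant]
    {G2 : Type*} [Group G2] [TopologicalSpace G2] [IsTopologicalGroup G2]
    [LocallyCompactSpace G2] [SecondCountableTopology G2] [T2Space G2]
    [MeasurableSpace G2] [BorelSpace G2]
    (m2 : Measure G2) [m2.IsHaarMeasure] [m2.IsMulRightInvariant]
    (K : Subgroup G2) (hKc : IsCompact (K : Set G2)) 
    (hK1 : m2 (K : Set G2) = 1)
    (Γ : Subgroup (G1 × G2)) [DiscreteTopology Γ]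
    (F : Set (G1 × G2))
    (hF : IsFundamentalDomain Γ.op F (m1.prod m2))
    (μ : Measure ((G1 × G2) ⧸ Γ))
    (hμ : μ = Measure.map (QuotientGroup.mk : G1 × G2 → (G1 × G2) ⧸ Γ)
      ((m1.prod m2).restrict F))
    (k Csp : ℝ) (hCsp : 0 < Csp)
    (Q : Set G1) (hQm : MeasurableSet Q) (hQb : Bornology.IsBounded Q) :
    ∃ M : ℝ≥0∞, M ≠ ⊤ ∧ ∀ S : Set G2, IsCompact S → (∀ u ∈ K, ∀ s ∈ S, u * s ∈ S) →
      (∀ u ∈ K, ∀ s ∈ S, s * u ∈ S) → 0 < m2 S →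
      (∀ φ : (G1 × G2) ⧸ Γ → ℝ, MemLp φ 2 μ →
      eLpNorm (fun y => ((m2 S).toReal)⁻¹ *
          (∫ s in S, φ (((1 : G1), s) • y) ∂m2) - ∫ z, φ z ∂μ) 2 μ ≤
        ENNReal.ofReal (Csp * (m2 S).toReal ^ (-k)) * eLpNorm φ 2 μ) →
      ∀ r : ℝ, r ≤ 1 →
      ∫⁻ x in Q, ‖(psi Γ ((Metric.closedBall (1 : G1) r ×ˢ S⁻¹).indicator 1)
        (QuotientGroup.mk (x, 1))).toReal - (m1 (Metric.closedBall (1 : G1) r)).toReal *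
          (m2 S).toReal‖ₑ ^ 2 ∂m1 ≤ M * ENNReal.ofReal ((m2 S).toReal ^ (1 - k)) ^ 2 *
            m1 (Metric.closedBall (1 : G1) r) := by
  have hcountG : Countable Γ := by
    have : SecondCountableTopology Γ := inferInstance
    exact TopologicalSpace.separableSpace_iff_countable.1 inferInstance
  have hKm : MeasurableSet (K : Set G2) := hKc.isClosed.measurableSet
  obtain ⟨Mq, hMq, hMq'⟩ := mult_aux Γ (closure Q ×ˢ (K : Set G2))
    ((Metric.isCompact_of_isClosed_isBounded isClosed_closure hQb.closure).prod hKc)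
  obtain ⟨Mb, hMb, hMb'⟩ := mult_aux Γ (Metric.closedBall (1 : G1) 1 ×ˢ (K : Set G2))
    ((isCompact_closedBall _ _).prod hKc)
  refine ⟨Mq * Mb * ENNReal.ofReal Csp ^ 2, by finiteness, ?_⟩
  intro S hSc hSl hSr hS0 hSP r hr
  have hSm : MeasurableSet S := hSc.isClosed.measurableSet
  have hSfin : m2 S ≠ ⊤ := hSc.measure_lt_top.ne
  set B := Metric.closedBall (1 : G1) r with hB
  have hBm : MeasurableSet B := Metric.isClosed_closedBall.measurableSet
  have hBfin : m1 B ≠ ⊤ := (isCompact_closedBall _ _).measure_lt_top.ne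
  set ψ := psi Γ ((B ×ˢ (K : Set G2)).indicator 1) with hψ
  set N := psi Γ ((B ×ˢ S⁻¹).indicator 1) with hN
  set V := (m2 S).toReal with hV
  have hV0 : 0 < V := ENNReal.toReal_pos hS0.ne' hSfin
  have hψm : Measurable ψ := measurable_psi Γ _ (measurable_one.indicator (hBm.prod hKm))
  have hNm : Measurable N := measurable_psi Γ _ (measurable_one.indicator (hBm.prod hSm.inv))
  have hψb : ∀ y, ψ y ≤ Mb := fun y => (psi_mono Γ (Set.prod_mono
    (Metric.closedBall_subset_closedBall hr) subset_rfl) y).trans (hMb' y)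
  have hψint : ∫⁻ y, ψ y ∂μ = m1 B := by
    have := unfold_aux Γ (m1.prod m2) F hF μ hμ ((B ×ˢ (K : Set G2)).indicator 1)
      (measurable_one.indicator (hBm.prod hKm)) 1 measurable_one
    simp only [Pi.one_apply, mul_one] at this
    rw [hψ, ← this, lintegral_indicator_one (hBm.prod hKm), Measure.prod_prod, hK1, mul_one]
  have hψsq : ∫⁻ y, ‖(ψ y).toReal‖ₑ ^ 2 ∂μ ≤ Mb * m1 B := by
    rw [← hψint, ← lintegral_const_mul _ hψm]
    refine lintegral_mono fun y => ?_
    have hf : ψ y ≠ ⊤ := ne_top_of_le_ne_top hMb (hψb y)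
    simp only
    rw [Real.enorm_of_nonneg ENNReal.toReal_nonneg, ENNReal.ofReal_toReal hf, sq]
    gcongr
    exact hψb y
  have hφL : MemLp (fun y => (ψ y).toReal) 2 μ := by
    refine ⟨hψm.ennreal_toReal.aestronglyMeasurable, ?_⟩
    have h1 : eLpNorm (fun y => (ψ y).toReal) 2 μ ^ 2 < ⊤ := by
      rw [eLpNorm_two_sq]
      exact hψsq.trans_lt (by finiteness)
    by_contra h
    simp only [not_lt, top_le_iff] at h
    simp [h] at h1
  have h1 := hSP _ hφL
  have h2 : ∫ z, (ψ z).toReal ∂μ = (m1 B).toReal := by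
    rw [integral_toReal hψm.aemeasurable, hψint]
    exact Filter.Eventually.of_forall fun y => (hψb y).trans_lt hMb.lt_top
  have h3 : ∀ y, ∫ s in S, (ψ (((1 : G1), s) • y)).toReal ∂m2 = (N y).toReal := by
    intro y
    rw [integral_toReal, sph_avg m2 K hK1 hKm Γ S hSl]
    · refine Measurable.aemeasurable ?_
      refine hψm.comp ?_
      induction y using QuotientGroup.induction_on with
      | H g =>
      show Measurable fun s : G2 => (QuotientGroup.mk (((1 : G1), s) * g) : (G1 × G2) ⧸ Γ)
      exact (measurable_mk' Γ).comp (by fun_prop)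
    · exact Filter.Eventually.of_forall fun y => (hψb _).trans_lt hMb.lt_top
  simp only [h2, h3] at h1
  set W : (G1 × G2) ⧸ Γ → ℝ≥0∞ := fun y => ‖V⁻¹ * (N y).toReal - (m1 B).toReal‖ₑ ^ 2 with hW
  have hWm : Measurable W := by
    have := hNm.ennreal_toReal
    fun_prop
  have h4 : ∫⁻ y, W y ∂μ ≤ ENNReal.ofReal (Csp * V ^ (-k)) ^ 2 * (Mb * m1 B) := by
    rw [hW, ← eLpNorm_two_sq]
    calc _ ≤ _ := pow_le_pow_left' h1 2
      _ ≤ _ := by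
        rw [mul_pow, eLpNorm_two_sq]
        gcongr
  have h5 : ∫⁻ x in Q, W (QuotientGroup.mk (x, 1)) ∂m1 ≤ Mq * ∫⁻ y, W y ∂μ := by
    have e : ∫⁻ x in Q, W (QuotientGroup.mk (x, 1)) ∂m1 =
        ∫⁻ g in Q ×ˢ (K : Set G2), W (QuotientGroup.mk g) ∂(m1.prod m2) := by
      rw [← Measure.prod_restrict, lintegral_prod
        (fun g : G1 × G2 => W (QuotientGroup.mk g)) (hWm.comp (measurable_mk' Γ)).aemeasurable]
      refine lintegral_congr fun x => ?_
      have : ∫⁻ u in (K : Set G2), W (QuotientGroup.mk (x, u)) ∂m2 =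
          ∫⁻ u in (K : Set G2), W (QuotientGroup.mk (x, 1)) ∂m2 := by
        refine setLIntegral_congr_fun hKm fun u hu => ?_
        simp only [hW, hN, psi_K K Γ S hSr B x u hu]
      rw [this]
      simp [hK1]
    rw [e, ← lintegral_indicator (hQm.prod hKm)]
    have e2 := unfold_aux Γ (m1.prod m2) F hF μ hμ ((Q ×ˢ (K : Set G2)).indicator 1)
      (measurable_one.indicator (hQm.prod hKm)) W hWm
    have e3 : ∀ g, (Q ×ˢ (K : Set G2)).indicator (fun g => W (QuotientGroup.mk g)) g =
      (Q ×ˢ (K : Set G2)).indicator 1 g * W (QuotientGroup.mk g) := by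
      intro g
      simp only [Set.indicator]
      split_ifs <;> simp
    simp_rw [e3]
    rw [e2, ← lintegral_const_mul _ hWm]
    refine lintegral_mono fun y => ?_
    simp only
    gcongr
    exact (psi_mono Γ (Set.prod_mono subset_closure subset_rfl) y).trans (hMq' y)
  have h6 : ∀ x : G1, ‖(N (QuotientGroup.mk (x, 1))).toReal - (m1 B).toReal * V‖ₑ ^ 2 =
      ENNReal.ofReal V ^ 2 * W (QuotientGroup.mk (x, 1)) := by
    intro x
    rw [hW, ← mul_pow, ← Real.enorm_of_nonneg hV0.le, ← enorm_mul]
    congr 2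
    field_simp
  simp_rw [h6]
  rw [lintegral_const_mul' _ _ (by finiteness)]
  calc _ ≤ ENNReal.ofReal V ^ 2 * (Mq * (ENNReal.ofReal (Csp * V ^ (-k)) ^ 2 * (Mb * m1 B))) := by
        gcongr
        exact h5.trans (by gcongr)
    _ = _ := by
      rw [ENNReal.ofReal_mul hCsp.le, sub_eq_add_neg, Real.rpow_add hV0, Real.rpow_one,
        ENNReal.ofReal_mul hV0.le]
      ring

theorem real_height (p V h c1 ca a k e : ℝ) (hc1 : 0 < c1) (hca : 0 < ca)
    (hk : k < 1 / 2) (he : 0 < e) (hea : e < a) (hh : 1 ≤ h)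
    (hp : c1 * h ^ (-e) ≤ p) (hV : ca * h ^ a ≤ V) :
    (V ^ (1 - k)) ^ 2 * p ≤ (c1 ^ (2 * k - 1) * (c1 * ca) ^ (-(e * (1 - 2 * k) / (a - e)))) *
      ((p * V) ^ (((1 - k) * a - e / 2) / (a - e))) ^ 2 := by
  have hh0 : 0 < h := by linarith
  have hp0 : 0 < p := lt_of_lt_of_le (by positivity) hp
  have hV0 : 0 < V := lt_of_lt_of_le (by positivity) hV
  have hs : 0 < a - e := by linarith
  set β := e * (1 - 2 * k) / (a - e) with hβ
  have hβ0 : 0 ≤ β := by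
    apply div_nonneg _ hs.le
    apply mul_nonneg he.le; linarith
  have hexp : 2 * (((1 - k) * a - e / 2) / (a - e)) = (2 - 2 * k) + β := by
    rw [hβ]; field_simp; ring
  have hv : (c1 * ca) * h ^ (a - e) ≤ p * V := by
    calc (c1 * ca) * h ^ (a - e) = (c1 * h ^ (-e)) * (ca * h ^ a) := by
          rw [sub_eq_add_neg, Real.rpow_add hh0]; ring
      _ ≤ p * V := by gcongr
  have h1 : (c1 * ca) ^ β * h ^ (e * (1 - 2 * k)) ≤ (p * V) ^ β := by
    calc _ = ((c1 * ca) * h ^ (a - e)) ^ β := by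
          rw [Real.mul_rpow (x := c1 * ca) (by positivity) (by positivity), ← Real.rpow_mul hh0.le]
          congr 2
          rw [hβ]; field_simp
      _ ≤ _ := Real.rpow_le_rpow (by positivity) hv hβ0
  have h2 : p ^ (2 * k - 1) ≤ c1 ^ (2 * k - 1) * h ^ (e * (1 - 2 * k)) := by
    calc p ^ (2 * k - 1) ≤ (c1 * h ^ (-e)) ^ (2 * k - 1) :=
          Real.rpow_le_rpow_of_nonpos (by positivity) hp (by linarith)
      _ = _ := by
        rw [Real.mul_rpow (by positivity) (by positivity), ← Real.rpow_mul hh0.le]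
        congr 2; ring
  have h3 : (V ^ (1 - k)) ^ 2 * p = (p * V) ^ (2 - 2 * k) * p ^ (2 * k - 1) := by
    rw [Real.mul_rpow hp0.le hV0.le, ← Real.rpow_natCast, ← Real.rpow_mul hV0.le]
    have : p = p ^ (2 - 2 * k) * p ^ (2 * k - 1) := by
      rw [← Real.rpow_add hp0]; ring_nf; simp
    rw [show (1 - k) * ((2 : ℕ) : ℝ) = 2 - 2 * k by push_cast; ring]
    nth_rewrite 1 [this]
    ring
  have h4 : ((p * V) ^ (((1 - k) * a - e / 2) / (a - e))) ^ 2 =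
      (p * V) ^ (2 - 2 * k) * (p * V) ^ β := by
    rw [← Real.rpow_add (by positivity), ← hexp, ← Real.rpow_natCast,
      ← Real.rpow_mul (by positivity)]
    congr 1; push_cast; ring
  rw [h3, h4, Real.rpow_neg (by positivity)]
  have hcc : 0 < (c1 * ca) ^ β := by positivity
  calc _ ≤ (p * V) ^ (2 - 2 * k) * (c1 ^ (2 * k - 1) * h ^ (e * (1 - 2 * k))) := by gcongr
    _ = c1 ^ (2 * k - 1) * ((c1 * ca) ^ β)⁻¹ * ((p * V) ^ (2 - 2 * k) *
        ((c1 * ca) ^ β * h ^ (e * (1 - 2 * k)))) := by field_simp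
    _ ≤ _ := by gcongr

theorem card_eq_tsum {ι : Type*} (P : ι → Prop) :
    (Nat.card {i // P i} : ℝ) = (∑' i, ({i | P i}).indicator (1 : ι → ℝ≥0∞) i).toReal := by
  rw [← tsum_subtype]
  simp only [Pi.one_apply, ENNReal.tsum_set_one]
  have : Nat.card {i // P i} = ({i | P i}).encard.toNat := by
    rw [← Set.ncard_def]; rfl
  rw [this]
  cases h : ({i | P i}).encard using ENat.recTopCoe <;> simp

theorem count_eq {G1 : Type*} [Group G1] [MetricSpace G1]
    (hrt : ∀ x y g : G1, dist (x * g) (y * g) = dist x y)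
    {G2 : Type*} [Group G2] (Γ : Subgroup (G1 × G2)) (H : G2 → ℕ) (hH1 : ∀ g, 1 ≤ H g)
    (b : ℝ) (T : ℕ) (x : G1)
    (hfin : ∀ h : ℕ, psi Γ ((Metric.closedBall (1 : G1) ((h : ℝ) ^ (-b)) ×ˢ (H ⁻¹' {h})⁻¹).indicator 1)
        (QuotientGroup.mk (x, 1)) ≠ ⊤) :
    (Nat.card {γ : Γ //
              dist x (γ : G1 × G2).1 ≤ ((H (γ : G1 × G2).2 : ℝ)) ^ (-b) ∧
                H (γ : G1 × G2).2 ≤ T} : ℝ) = ∑ h ∈ Finset.Icc 1 T,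
      (psi Γ ((Metric.closedBall (1 : G1) ((h : ℝ) ^ (-b)) ×ˢ (H ⁻¹' {h})⁻¹).indicator 1)
        (QuotientGroup.mk (x, 1))).toReal := by
  rw [card_eq_tsum, ← ENNReal.toReal_sum (fun h _ => hfin h)]
  congr 1
  simp_rw [psi_mk]
  have e : ∀ h : ℕ, ∑' γ : Γ, (Metric.closedBall (1 : G1) ((h : ℝ) ^ (-b)) ×ˢ
      (H ⁻¹' {h})⁻¹).indicator (1 : G1 × G2 → ℝ≥0∞) ((x, 1) * (γ : G1 × G2)) =
      ∑' γ : Γ, if dist x (γ : G1 × G2).1 ≤ (h : ℝ) ^ (-b) ∧ H (γ : G1 × G2).2 = h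
        then 1 else 0 := by
    intro h
    rw [← (Equiv.inv Γ).tsum_eq]
    refine tsum_congr fun γ => ?_
    have : ((x, 1) * (((Equiv.inv Γ) γ : Γ) : G1 × G2) ∈
        Metric.closedBall (1 : G1) ((h : ℝ) ^ (-b)) ×ˢ (H ⁻¹' {h})⁻¹) ↔
        (dist x (γ : G1 × G2).1 ≤ (h : ℝ) ^ (-b) ∧ H (γ : G1 × G2).2 = h) := by
      rw [Set.mem_prod, Metric.mem_closedBall, ← hrt _ _ (γ : G1 × G2).1]
      simp
    by_cases hc : dist x (γ : G1 × G2).1 ≤ (h : ℝ) ^ (-b) ∧ H (γ : G1 × G2).2 = h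
    · rw [Set.indicator_of_mem (this.2 hc), if_pos hc]; rfl
    · rw [Set.indicator_of_notMem (fun h' => hc (this.1 h')), if_neg hc]
  simp_rw [e]
  rw [← Summable.tsum_finsetSum (fun _ _ => ENNReal.summable)]
  refine tsum_congr fun γ => ?_
  by_cases hc : dist x (γ : G1 × G2).1 ≤ (H (γ : G1 × G2).2 : ℝ) ^ (-b) ∧ H (γ : G1 × G2).2 ≤ T
  · rw [Set.indicator_of_mem (by exact hc), Finset.sum_eq_single (H (γ : G1 × G2).2)]
    · simp [hc.1]
    · intro h _ hne
      rw [if_neg]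
      exact fun h' => hne h'.2.symm
    · intro h
      exact absurd (Finset.mem_Icc.2 ⟨hH1 _, hc.2⟩) h
  · rw [Set.indicator_of_notMem (by exact hc)]
    symm
    refine Finset.sum_eq_zero fun h hh => ?_
    rw [if_neg]
    rintro ⟨h1, h2⟩
    rw [← h2] at h1 hh
    exact hc ⟨h1, (Finset.mem_Icc.1 hh).2⟩

/-- Combination of the per-height estimates. -/
theorem combine {X : Type*} [MeasurableSpace X] (ν : Measure X) (f : ℕ → X → ℝ) (v : ℕ → ℝ)
    (L : Set ℕ) (hv0 : ∀ h, 0 ≤ v h) (hvL : ∀ h, h ∉ L → v h = 0)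
    (hfL : ∀ h, h ∉ L → ∀ x, f h x = 0) (θ0 θ C2 c s : ℝ) (hθ0 : 0 < θ0) (hθ : θ0 < θ)
    (hC2 : 0 < C2) (hc : 0 < c) (hs : 0 < s)
    (hfi : ∀ h ∈ L, Integrable (fun x => f h x ^ 2) ν)
    (hf2 : ∀ h ∈ L, 1 ≤ h → ∫ x, f h x ^ 2 ∂ν ≤ C2 * (v h ^ θ0) ^ 2)
    (hvlow : ∀ h ∈ L, 1 ≤ h → c * (h : ℝ) ^ s ≤ v h)
    (hC : ∀ η : ℝ, 0 < η → ∃ Cη : ℝ, 0 < Cη ∧ ∀ T : ℕ, 1 ≤ T →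
      ((L ∩ Set.Icc 1 T).ncard : ℝ) ≤ Cη * (T : ℝ) ^ η)
    (hG : ∃ Δ : ℝ, 1 ≤ Δ ∧ ∃ T1 : ℝ, ∀ T : ℝ, T1 ≤ T →
      ∃ h : ℕ, h ∈ L ∧ T / Δ ≤ (h : ℝ) ∧ (h : ℝ) ≤ T) :
    ∃ C : ℝ, 0 < C ∧ ∀ T : ℕ, 1 ≤ T →
      Real.sqrt (∫ x, (∑ h ∈ Finset.Icc 1 T, f h x) ^ 2 ∂ν) ≤
        C * (∑ h ∈ Finset.Icc 1 T, v h) ^ θ := by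
  classical
  obtain ⟨Δ, hΔ, T1, hT1⟩ := hG
  obtain ⟨Cη, hCη, hcard⟩ := hC ((θ - θ0) * s) (mul_pos (by linarith) hs)
  -- lower bound for the total volume
  obtain ⟨c', hc', hlow⟩ : ∃ c' : ℝ, 0 < c' ∧ ∀ T : ℕ, 1 ≤ T →
      (∃ h ∈ L, 1 ≤ h ∧ h ≤ T) → c' * (T : ℝ) ^ s ≤ ∑ h ∈ Finset.Icc 1 T, v h := by
    set D := max Δ (max T1 1) with hD
    have hD1 : Δ ≤ D := le_max_left _ _
    have hD2 : T1 ≤ D := (le_max_left _ _).trans (le_max_right _ _)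
    have hD0 : 0 < D := by linarith
    refine ⟨c * (D⁻¹) ^ s, by positivity, ?_⟩
    intro T hT hex
    have hT0 : (0 : ℝ) < T := by exact_mod_cast hT
    obtain ⟨h, hL, h1, h2, h3⟩ : ∃ h ∈ L, 1 ≤ h ∧ h ≤ T ∧ (T : ℝ) / D ≤ h := by
      by_cases hTT : T1 ≤ T
      · obtain ⟨h, hL, h1, h2⟩ := hT1 T hTT
        have hh : (0 : ℝ) < h := lt_of_lt_of_le (by positivity) h1
        refine ⟨h, hL, by exact_mod_cast hh, by exact_mod_cast h2, le_trans ?_ h1⟩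
        gcongr
      · obtain ⟨h, hL, h1, h2⟩ := hex
        refine ⟨h, hL, h1, h2, ?_⟩
        have : (1 : ℝ) ≤ h := by exact_mod_cast h1
        refine le_trans ?_ this
        rw [div_le_one hD0]
        linarith
    calc c * (D⁻¹) ^ s * (T : ℝ) ^ s = c * ((T : ℝ) / D) ^ s := by
          rw [div_eq_inv_mul, Real.mul_rpow (by positivity) hT0.le]; ring
      _ ≤ c * (h : ℝ) ^ s := by gcongr
      _ ≤ v h := hvlow h hL h1
      _ ≤ _ := Finset.single_le_sum (fun i _ => hv0 i) (Finset.mem_Icc.2 ⟨h1, h2⟩)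
  refine ⟨Real.sqrt C2 * Cη * (c' ^ (θ - θ0))⁻¹, by positivity, ?_⟩
  intro T hT
  have hT0 : (0 : ℝ) < T := by exact_mod_cast hT
  set VT := ∑ h ∈ Finset.Icc 1 T, v h with hVT
  have hVT0 : 0 ≤ VT := Finset.sum_nonneg fun i _ => hv0 i
  by_cases hex : ∃ h ∈ L, 1 ≤ h ∧ h ≤ T
  swap
  · have hz : ∀ x, ∑ h ∈ Finset.Icc 1 T, f h x = 0 := fun x => Finset.sum_eq_zero fun h hh =>
      hfL h (fun hL => hex ⟨h, hL, Finset.mem_Icc.1 hh⟩) x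
    simp only [hz]
    simp
    positivity
  have hlowT := hlow T hT hex
  have hVTpos : 0 < VT := lt_of_lt_of_le (by positivity) hlowT
  set LT := (Finset.Icc 1 T).filter (· ∈ L) with hLT
  have hLTm : ∀ h ∈ LT, h ∈ L ∧ 1 ≤ h ∧ h ≤ T := by
    intro h hh
    rw [hLT, Finset.mem_filter, Finset.mem_Icc] at hh
    exact ⟨hh.2, hh.1⟩
  have hcardT : (LT.card : ℝ) ≤ Cη * (T : ℝ) ^ ((θ - θ0) * s) := by
    have : (L ∩ Set.Icc 1 T) = (LT : Set ℕ) := by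
      ext h
      simp only [hLT, Set.mem_inter_iff, Set.mem_Icc, Finset.coe_filter, Finset.mem_Icc,
        Set.mem_ofPred_eq]
      tauto
    have h2 := hcard T hT
    rwa [this, Set.ncard_coe_finset] at h2
  have hsum : ∀ x, ∑ h ∈ Finset.Icc 1 T, f h x = ∑ h ∈ LT, f h x := by
    intro x
    rw [hLT, Finset.sum_filter]
    refine Finset.sum_congr rfl fun h _ => ?_
    split_ifs with hh
    · rfl
    · exact hfL h hh x
  have hint : ∫ x, (∑ h ∈ Finset.Icc 1 T, f h x) ^ 2 ∂ν ≤
      (LT.card * (Real.sqrt C2 * VT ^ θ0)) ^ 2 := by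
    calc _ ≤ ∫ x, (LT.card : ℝ) * ∑ h ∈ LT, f h x ^ 2 ∂ν := by
          refine integral_mono_of_nonneg (Filter.Eventually.of_forall fun x => sq_nonneg _) ?_
            (Filter.Eventually.of_forall fun x => ?_)
          · exact (integrable_finsetSum _ fun h hh => hfi h (hLTm h hh).1).const_mul _
          · simp only [hsum]
            exact sq_sum_le_card_mul_sum_sq
      _ = (LT.card : ℝ) * ∑ h ∈ LT, ∫ x, f h x ^ 2 ∂ν := by
          rw [integral_const_mul, integral_finsetSum _ fun h hh => hfi h (hLTm h hh).1]
      _ ≤ (LT.card : ℝ) * ∑ h ∈ LT, C2 * (VT ^ θ0) ^ 2 := by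
          gcongr with h hh
          obtain ⟨hL, h1, h2⟩ := hLTm h hh
          refine (hf2 h hL h1).trans ?_
          have hv := hv0 h
          have : v h ≤ VT := Finset.single_le_sum (fun i _ => hv0 i) (Finset.mem_Icc.2 ⟨h1, h2⟩)
          gcongr
      _ = _ := by
          rw [Finset.sum_const, nsmul_eq_mul, mul_pow, mul_pow, Real.sq_sqrt hC2.le]
          ring
  have hTs : c' ^ (θ - θ0) * (T : ℝ) ^ ((θ - θ0) * s) ≤ VT ^ (θ - θ0) := by
    calc _ = (c' * (T : ℝ) ^ s) ^ (θ - θ0) := by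
          rw [Real.mul_rpow hc'.le (by positivity), ← Real.rpow_mul hT0.le, mul_comm s]
      _ ≤ _ := Real.rpow_le_rpow (by positivity) hlowT (by linarith)
  calc _ ≤ Real.sqrt ((LT.card * (Real.sqrt C2 * VT ^ θ0)) ^ 2) := Real.sqrt_le_sqrt hint
    _ = LT.card * (Real.sqrt C2 * VT ^ θ0) := Real.sqrt_sq (by positivity)
    _ ≤ (Cη * (T : ℝ) ^ ((θ - θ0) * s)) * (Real.sqrt C2 * VT ^ θ0) := by gcongr
    _ = Real.sqrt C2 * Cη * (c' ^ (θ - θ0))⁻¹ *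
        ((c' ^ (θ - θ0) * (T : ℝ) ^ ((θ - θ0) * s)) * VT ^ θ0) := by
          have : 0 < c' ^ (θ - θ0) := by positivity
          field_simp
    _ ≤ Real.sqrt C2 * Cη * (c' ^ (θ - θ0))⁻¹ * (VT ^ (θ - θ0) * VT ^ θ0) := by gcongr
    _ = _ := by rw [← Real.rpow_add hVTpos]; ring_nf


end aux

/-- The measure-theoretic core of the paper's analogue of W. Schmidt's theorem
(Theorem 3.2, 'ae-disc'): a mean-square asymptotic for the Diophantine counting function
`N_T(x) = #{γ = (γ₁,γ₂) ∈ Γ : dist(x,γ₁) ≤ H(γ₂)^{-b}, H(γ₂) ≤ T}` in terms of the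
volume sum `V_T = ∑_{h=1}^T m1(B(e,h^{-b})) · m2(Σ(h))`, under the height-sphere volume
bound (V1), the counting bound (C), the gap condition (G), and the effective mean
ergodic theorem (SP). -/
theorem schmidt_mean_square
    {G1 : Type*} [Group G1] [MetricSpace G1] [IsTopologicalGroup G1]
    [SecondCountableTopology G1] [ProperSpace G1] [LocallyCompactSpace G1]
    [MeasurableSpace G1] [BorelSpace G1]
    (m1 : Measure G1) [m1.IsHaarMeasure] [m1.IsMulRightInvariant]
    (hrt : ∀ x y g : G1, dist (x * g) (y * g) = dist x y)
    (d c1 c2 : ℝ) (hd : 0 < d) (hc1 : 0 < c1) (hc12 : c1 ≤ c2)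
    (hball : ∀ r : ℝ, 0 < r → r ≤ 1 →
      ENNReal.ofReal (c1 * r ^ d) ≤ m1 (Metric.closedBall (1 : G1) r) ∧
        m1 (Metric.closedBall (1 : G1) r) ≤ ENNReal.ofReal (c2 * r ^ d))
    {G2 : Type*} [Group G2] [TopologicalSpace G2] [IsTopologicalGroup G2]
    [LocallyCompactSpace G2] [SecondCountableTopology G2] [T2Space G2]
    [MeasurableSpace G2] [BorelSpace G2]
    (m2 : Measure G2) [m2.IsHaarMeasure] [m2.IsMulRightInvariant]
    (K : Subgroup G2) (hKc : IsCompact (K : Set G2)) (hKo : IsOpen (K : Set G2))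
    (hK1 : m2 (K : Set G2) = 1)
    (Γ : Subgroup (G1 × G2)) [DiscreteTopology Γ]
    (F : Set (G1 × G2))
    (hF : IsFundamentalDomain Γ.op F (m1.prod m2))
    (hFvol : (m1.prod m2) F = 1)
    (μ : Measure ((G1 × G2) ⧸ Γ))
    (hμ : μ = Measure.map (QuotientGroup.mk : G1 × G2 → (G1 × G2) ⧸ Γ)
      ((m1.prod m2).restrict F))
    (H : G2 → ℕ) (hH1 : ∀ g, 1 ≤ H g)
    (hHbi : ∀ u ∈ K, ∀ v ∈ K, ∀ g : G2, H (u * g * v) = H g)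
    (hHcpt : ∀ h : ℕ, IsCompact (H ⁻¹' {h}))
    -- (V1): volume lower bound for the nonempty height spheres
    (ca a : ℝ) (hca : 0 < ca) (ha : 0 < a)
    (hV1 : ∀ h : ℕ, 0 < m2 (H ⁻¹' {h}) →
      ENNReal.ofReal (ca * (h : ℝ) ^ a) ≤ m2 (H ⁻¹' {h}))
    -- (C): counting bound for the set of heights
    (hC : ∀ η : ℝ, 0 < η → ∃ Cη : ℝ, 0 < Cη ∧ ∀ T : ℕ, 1 ≤ T →
      (({h : ℕ | 0 < m2 (H ⁻¹' {h})} ∩ Set.Icc 1 T).ncard : ℝ) ≤ Cη * (T : ℝ) ^ η)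
    -- (G): bounded multiplicative gaps for the set of heights
    (hG : ∃ Δ : ℝ, 1 ≤ Δ ∧ ∃ T1 : ℝ, ∀ T : ℝ, T1 ≤ T →
      ∃ h : ℕ, 0 < m2 (H ⁻¹' {h}) ∧ T / Δ ≤ (h : ℝ) ∧ (h : ℝ) ≤ T)
    -- (SP): effective mean ergodic theorem for the height-sphere averages
    (k Csp : ℝ) (hk0 : 0 < k) (hk : k < 1 / 2) (hCsp : 0 < Csp)
    (hSP : ∀ h : ℕ, 0 < m2 (H ⁻¹' {h}) → ∀ φ : (G1 × G2) ⧸ Γ → ℝ, MemLp φ 2 μ →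
      eLpNorm (fun y => ((m2 (H ⁻¹' {h})).toReal)⁻¹ *
          (∫ s in H ⁻¹' {h}, φ (((1 : G1), s) • y) ∂m2) - ∫ z, φ z ∂μ) 2 μ ≤
        ENNReal.ofReal (Csp * (m2 (H ⁻¹' {h})).toReal ^ (-k)) * eLpNorm φ 2 μ)
    (b : ℝ) (hb0 : 0 < b) (hb : b < 2 * a * k / d)
    (θ : ℝ) (hθ0 : ((1 - k) * a - b * d / 2) / (a - b * d) < θ) (hθ1 : θ < 1)
    (Q : Set G1) (hQm : MeasurableSet Q) (hQb : Bornology.IsBounded Q) :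
    ∃ C : ℝ, 0 < C ∧ ∀ T : ℕ, 1 ≤ T →
      Real.sqrt (∫ x in Q,
          ((Nat.card {γ : Γ //
              dist x (γ : G1 × G2).1 ≤ ((H (γ : G1 × G2).2 : ℝ)) ^ (-b) ∧
                H (γ : G1 × G2).2 ≤ T} : ℝ) -
            ∑ h ∈ Finset.Icc 1 T,
              (m1 (Metric.closedBall (1 : G1) ((h : ℝ) ^ (-b)))).toReal *
                (m2 (H ⁻¹' {h})).toReal) ^ 2 ∂m1) ≤
        C * (∑ h ∈ Finset.Icc 1 T,
            (m1 (Metric.closedBall (1 : G1) ((h : ℝ) ^ (-b)))).toReal *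
              (m2 (H ⁻¹' {h})).toReal) ^ θ := by

  have hbd : b * d < 2 * a * k := by rwa [lt_div_iff₀ hd] at hb
  have he0 : 0 < b * d := mul_pos hb0 hd
  have hea : b * d < a := by nlinarith
  have hs : 0 < a - b * d := by linarith
  set L : Set ℕ := {h : ℕ | 0 < m2 (H ⁻¹' {h})} with hL
  set p : ℕ → ℝ := fun h => (m1 (Metric.closedBall (1 : G1) ((h : ℝ) ^ (-b)))).toReal with hp
  set V : ℕ → ℝ := fun h => (m2 (H ⁻¹' {h})).toReal with hV
  set n : ℕ → G1 → ENNReal := fun h x =>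
    psi Γ ((Metric.closedBall (1 : G1) ((h : ℝ) ^ (-b)) ×ˢ (H ⁻¹' {h})⁻¹).indicator 1)
        (QuotientGroup.mk (x, 1)) with hn
  have hcountG : Countable Γ := TopologicalSpace.separableSpace_iff_countable.1 inferInstance
  have hSl : ∀ h : ℕ, ∀ u ∈ K, ∀ s ∈ H ⁻¹' {h}, u * s ∈ H ⁻¹' {h} := by
    intro h u hu s hs
    have := hHbi u hu 1 K.one_mem s
    rw [mul_one] at this
    simpa [this] using hs
  have hSr : ∀ h : ℕ, ∀ u ∈ K, ∀ s ∈ H ⁻¹' {h}, s * u ∈ H ⁻¹' {h} := by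
    intro h u hu s hs
    have := hHbi 1 K.one_mem u hu s
    rw [one_mul] at this
    simpa [this] using hs
  have hempty : ∀ h, h ∉ L → H ⁻¹' {h} = ∅ := by
    intro h hh
    by_contra hne
    obtain ⟨g, hg⟩ := Set.nonempty_iff_ne_empty.2 hne
    apply hh
    have h1 : m2 ((fun s => g⁻¹ * s) ⁻¹' (K : Set G2)) = 1 := by
      rw [measure_preimage_mul, hK1]
    have h2 : (fun s => g⁻¹ * s) ⁻¹' (K : Set G2) ⊆ H ⁻¹' {h} := by
      intro s hs
      simpa using hSr h _ hs _ hg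
    show 0 < m2 (H ⁻¹' {h})
    exact lt_of_lt_of_le (by rw [h1]; exact one_pos) (measure_mono h2)
  have hnfin : ∀ h x, n h x ≠ ⊤ := by
    intro h x
    obtain ⟨M, hM, hM'⟩ := mult_aux Γ
      (Metric.closedBall (1 : G1) ((h : ℝ) ^ (-b)) ×ˢ (H ⁻¹' {h})⁻¹)
      ((isCompact_closedBall _ _).prod (hHcpt h).inv)
    exact ne_top_of_le_ne_top hM (hM' _)
  have hnm : ∀ h, Measurable (n h) := by
    intro h
    refine (measurable_psi Γ _ (measurable_one.indicator
      (Metric.isClosed_closedBall.measurableSet.prod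
        (hHcpt h).isClosed.measurableSet.inv))).comp ((measurable_mk' Γ).comp (by fun_prop))
  set f : ℕ → G1 → ℝ := fun h x => (n h x).toReal - p h * V h with hf
  obtain ⟨M, hM, hsingle⟩ := single m1 m2 K hKc hK1 Γ F hF μ hμ k Csp hCsp Q hQm hQb
  have hr1 : ∀ h : ℕ, 1 ≤ h → (h : ℝ) ^ (-b) ≤ 1 := fun h hh =>
    Real.rpow_le_one_of_one_le_of_nonpos (by exact_mod_cast hh) (by linarith)
  have hL1 : ∀ h ∈ L, 1 ≤ h := by
    intro h hh
    by_contra h0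
    have hz : H ⁻¹' {h} = ∅ := by
      ext g
      have := hH1 g
      simp only [Set.mem_preimage, Set.mem_singleton_iff, Set.mem_empty_iff_false, iff_false]
      omega
    have hh' : 0 < m2 (H ⁻¹' {h}) := hh
    simp [hz] at hh'
  have hlint : ∀ h ∈ L, ∫⁻ x in Q, ‖f h x‖ₑ ^ 2 ∂m1 ≤
      M * ENNReal.ofReal (V h ^ (1 - k)) ^ 2 * ENNReal.ofReal (p h) := by
    intro h hh
    have h1 := hsingle (H ⁻¹' {h}) (hHcpt h) (hSl h) (hSr h) hh (hSP h hh) _ (hr1 h (hL1 h hh))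
    rw [hp, ENNReal.ofReal_toReal (isCompact_closedBall _ _).measure_lt_top.ne]
    exact h1
  have hfm : ∀ h, Measurable (f h) := fun h => (hnm h).ennreal_toReal.sub_const _
  have hsq : ∀ h x, ‖f h x ^ 2‖ₑ = ‖f h x‖ₑ ^ 2 := fun h x => enorm_pow _ _
  have hfi : ∀ h ∈ L, Integrable (fun x => f h x ^ 2) (m1.restrict Q) := by
    intro h hh
    refine ⟨((hfm h).pow_const 2).aestronglyMeasurable, ?_⟩
    rw [HasFiniteIntegral]
    simp_rw [hsq]
    exact (hlint h hh).trans_lt (by finiteness)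
  have hplow : ∀ h ∈ L, c1 * (h : ℝ) ^ (-(b * d)) ≤ p h := by
    intro h hh
    have h1 : (1 : ℝ) ≤ h := by exact_mod_cast hL1 h hh
    have h2 := (hball ((h : ℝ) ^ (-b)) (by positivity) (hr1 h (hL1 h hh))).1
    rw [← Real.rpow_mul (by positivity), neg_mul] at h2
    exact (ENNReal.ofReal_le_iff_le_toReal (isCompact_closedBall _ _).measure_lt_top.ne).1 h2
  have hVlow : ∀ h ∈ L, ca * (h : ℝ) ^ a ≤ V h := by
    intro h hh
    exact (ENNReal.ofReal_le_iff_le_toReal (hHcpt h).measure_lt_top.ne).1 (hV1 h hh)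
  have hp0 : ∀ h, 0 ≤ p h := fun h => ENNReal.toReal_nonneg
  have hV0 : ∀ h, 0 ≤ V h := fun h => ENNReal.toReal_nonneg
  have hf2 : ∀ h ∈ L, ∫ x in Q, f h x ^ 2 ∂m1 ≤ M.toReal * ((V h ^ (1 - k)) ^ 2 * p h) := by
    intro h hh
    rw [integral_eq_lintegral_of_nonneg_ae (Filter.Eventually.of_forall fun x => sq_nonneg _)
      ((hfm h).pow_const 2).aestronglyMeasurable]
    have e : ∀ x, ENNReal.ofReal (f h x ^ 2) = ‖f h x‖ₑ ^ 2 := fun x => by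
      rw [← hsq, Real.enorm_of_nonneg (sq_nonneg _)]
    simp_rw [e]
    have hh2 := ENNReal.toReal_mono (by finiteness) (hlint h hh)
    refine hh2.trans (le_of_eq ?_)
    rw [ENNReal.toReal_mul, ENNReal.toReal_mul, ENNReal.toReal_pow,
      ENNReal.toReal_ofReal (Real.rpow_nonneg (hV0 h) _), ENNReal.toReal_ofReal (hp0 h), mul_assoc]
  set C2 := c1 ^ (2 * k - 1) * (c1 * ca) ^ (-(b * d * (1 - 2 * k) / (a - b * d))) with hC2
  have hC20 : 0 < C2 := by positivity
  have hθ00 : 0 < ((1 - k) * a - b * d / 2) / (a - b * d) := by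
    apply div_pos _ hs
    nlinarith
  have main := combine (m1.restrict Q) f (fun h => p h * V h) L
    (fun h => mul_nonneg (hp0 h) (hV0 h))
    (fun h hh => by simp [hV, hempty h hh])
    (fun h hh x => by simp [hf, hn, hV, hempty h hh, psi_mk])
    (((1 - k) * a - b * d / 2) / (a - b * d)) θ ((M.toReal + 1) * C2) (c1 * ca) (a - b * d)
    hθ00 hθ0 (by positivity) (by positivity) hs hfi
    (fun h hh h1 => by
      refine (hf2 h hh).trans ?_
      have := real_height (p h) (V h) h c1 ca a k (b * d) hc1 hca hk he0 hea
        (by exact_mod_cast h1) (hplow h hh) (hVlow h hh)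
      have hnn : 0 ≤ (V h ^ (1 - k)) ^ 2 * p h := mul_nonneg (sq_nonneg _) (hp0 h)
      rw [mul_assoc]
      gcongr
      linarith)
    (fun h hh h1 => by
      have hh0 : (0 : ℝ) < h := by exact_mod_cast h1
      calc (c1 * ca) * (h : ℝ) ^ (a - b * d)
          = (c1 * (h : ℝ) ^ (-(b * d))) * (ca * (h : ℝ) ^ a) := by
            rw [sub_eq_add_neg, Real.rpow_add hh0]; ring
        _ ≤ p h * V h := by
          have := hplow h hh
          have := hVlow h hh
          have := hp0 h
          gcongr)
    hC hG
  obtain ⟨C, hC0, hmain⟩ := main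
  refine ⟨C, hC0, fun T hT => ?_⟩
  have hm := hmain T hT
  have e : ∀ x, ∑ h ∈ Finset.Icc 1 T, f h x =
      (Nat.card {γ : Γ //
              dist x (γ : G1 × G2).1 ≤ ((H (γ : G1 × G2).2 : ℝ)) ^ (-b) ∧
                H (γ : G1 × G2).2 ≤ T} : ℝ) - ∑ h ∈ Finset.Icc 1 T, p h * V h := by
    intro x
    rw [count_eq hrt Γ H hH1 b T x (fun h => hnfin h x), ← Finset.sum_sub_distrib]
  simp_rw [e] at hm
  exact hm
end

section
/- Under exactly the hypotheses of the preceding statement (groups G1, G2, lattice Γ of covolume one, K-bi-invariant height H with level sets Σ(h), hypotheses (V1), (C), (G), (SP), exponent b with 0 < b < 2ak/d, θ0 := ((1−k)a − bd/2)/(a − bd), and the functions N_T(x) := #{γ = (γ1,γ2) ∈ Γ : ρ(x, γ1) ≤ H(γ2)^{−b} and H(γ2) ≤ T} and V_T := ∑_{h=1}^{T} m1(B(e, h^{−b}))·m2(Σ(h))), for every θ' ∈ (θ0, 1) and for m1-almost every x ∈ G1 there exists a constant C_x such that |N_T(x) − V_T| ≤ C_x·V_T^{θ'} for all T ≥ 1.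 -/
open MeasureTheory

theorem sch_summable (S : Set ℕ) (hS0 : 0 ∉ S)
    (hC : ∀ η : ℝ, 0 < η → ∃ Cη : ℝ, 0 < Cη ∧ ∀ T : ℕ, 1 ≤ T →
      ((S ∩ Set.Icc 1 T).ncard : ℝ) ≤ Cη * (T : ℝ) ^ η) (ε : ℝ) (hε : 0 < ε) :
    Summable (fun h : S => ((h : ℕ) : ℝ) ^ (-ε)) := by
  obtain ⟨C, hC0, hC⟩ := hC (ε / 2) (by positivity)
  let A : S → ℕ := fun h => (S ∩ Set.Icc 1 (h : ℕ)).ncard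
  have hfin : ∀ n : ℕ, (S ∩ Set.Icc 1 n).Finite := fun n => (Set.finite_Icc 1 n).inter_of_right _
  have hpos : ∀ h : S, 1 ≤ (h : ℕ) := fun h => Nat.one_le_iff_ne_zero.2 (fun h0 => hS0 (h0 ▸ h.2))
  have hA : StrictMono A := by
    intro x y hxy
    apply Set.ncard_lt_ncard _ (hfin _)
    refine ⟨fun z hz => ⟨hz.1, hz.2.1, hz.2.2.trans hxy.le⟩, fun hsub => ?_⟩
    have := hsub ⟨y.2, hpos y, le_refl _⟩
    exact absurd this.2.2 (not_le.2 hxy)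
  have hApos : ∀ h : S, 0 < A h := fun h =>
    (Set.ncard_pos (hfin _)).2 ⟨h, h.2, hpos h, le_refl _⟩
  have h2 : Summable (fun n : ℕ => C ^ 2 * (1 / (n : ℝ) ^ 2)) :=
    (Real.summable_one_div_nat_pow.2 (by norm_num)).mul_left _
  refine Summable.of_nonneg_of_le (fun h => by positivity) (fun h => ?_)
    (h2.comp_injective hA.injective)
  have hh : (0 : ℝ) < (h : ℕ) := by exact_mod_cast hpos h
  have h3 := hC h (hpos h)
  have hAr : (0 : ℝ) < A h := by exact_mod_cast hApos h
  have h4 : (((h : ℕ) : ℝ) ^ (-ε)) = 1 / (((h : ℕ) : ℝ) ^ (ε / 2)) ^ 2 := by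
    rw [← Real.rpow_natCast, ← Real.rpow_mul hh.le, Real.rpow_neg hh.le]
    norm_num
  show (((h : ℕ) : ℝ) ^ (-ε)) ≤ C ^ 2 * (1 / (A h : ℝ) ^ 2)
  rw [h4, mul_one_div, div_le_div_iff₀ (by positivity) (by positivity), one_mul, ← mul_pow]
  exact pow_le_pow_left₀ hAr.le h3 2

theorem sch_ineq (k a b d θ ca c1 : ℝ) (hk : k < 1 / 2) (hca : 0 < ca) (hc1 : 0 < c1)
    (hθ : 1 - k ≤ θ) : ∃ C : ℝ, 0 < C ∧ ∀ h m β : ℝ, 1 ≤ h → ca * h ^ a ≤ m →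
      c1 * (h ^ (-b)) ^ d ≤ β →
      m ^ (1 - k) * β ^ (1 / 2 : ℝ) ≤
        C * (β * m) ^ θ * h ^ (-(θ * (a - b * d) - ((1 - k) * a - b * d / 2))) := by
  refine ⟨ca ^ (1 - k - θ) * c1 ^ (1 / 2 - θ), by positivity, fun h m β hh hm hβ => ?_⟩
  have h0 : 0 < h := by linarith
  have hm0 : 0 < m := lt_of_lt_of_le (by positivity) hm
  have hβ0 : 0 < β := lt_of_lt_of_le (by positivity) hβ
  have e1 : m ^ (1 - k) * β ^ (1 / 2 : ℝ) =
      (β * m) ^ θ * (m ^ (1 - k - θ) * β ^ (1 / 2 - θ)) := by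
    rw [Real.mul_rpow hβ0.le hm0.le, Real.rpow_sub hm0 (1 - k) θ, Real.rpow_sub hβ0]
    field_simp
  have e2 : m ^ (1 - k - θ) ≤ (ca * h ^ a) ^ (1 - k - θ) :=
    Real.rpow_le_rpow_of_nonpos (by positivity) hm (by linarith)
  have e3 : β ^ (1 / 2 - θ) ≤ (c1 * (h ^ (-b)) ^ d) ^ (1 / 2 - θ) :=
    Real.rpow_le_rpow_of_nonpos (by positivity) hβ (by linarith)
  have e4 : (ca * h ^ a) ^ (1 - k - θ) * (c1 * (h ^ (-b)) ^ d) ^ (1 / 2 - θ) =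
      ca ^ (1 - k - θ) * c1 ^ (1 / 2 - θ) *
        h ^ (-(θ * (a - b * d) - ((1 - k) * a - b * d / 2))) := by
    rw [Real.mul_rpow hca.le (by positivity), Real.mul_rpow hc1.le (by positivity),
      ← Real.rpow_mul h0.le, ← Real.rpow_mul h0.le, ← Real.rpow_mul h0.le]
    have : h ^ (-(θ * (a - b * d) - ((1 - k) * a - b * d / 2))) =
      h ^ (a * (1 - k - θ)) * h ^ (-b * d * (1 / 2 - θ)) := by
      rw [← Real.rpow_add h0]; congr 1; ring
    rw [this]; ring
  rw [e1]
  calc _ ≤ (β * m) ^ θ * ((ca * h ^ a) ^ (1 - k - θ) * (c1 * (h ^ (-b)) ^ d) ^ (1 / 2 - θ)) := by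
        gcongr
    _ = _ := by rw [e4]; ring

theorem sch_bc {α ι : Type*} [Countable ι] [MeasurableSpace α] (μ : Measure α)
    (f : ι → α → ℝ) (hf : ∀ i, Measurable (f i)) (c q : ι → ℝ) (hc : ∀ i, 0 < c i)
    (hs : Summable (fun i => q i ^ 2))
    (hb : ∀ i, eLpNorm (f i) 2 μ ≤ ENNReal.ofReal (c i)) :
    ∀ᵐ y ∂μ, ∃ C : ℝ, 0 < C ∧ ∀ i, |f i y| * q i ≤ C * c i := by
  let g : ι → α → ENNReal := fun i y => ENNReal.ofReal ((q i / c i) ^ 2) * ‖f i y‖ₑ ^ 2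
  have hg : ∀ i, Measurable (g i) := fun i => ((hf i).enorm.pow_const 2).const_mul _
  have hint : ∀ i, ∫⁻ y, g i y ∂μ ≤ ENNReal.ofReal (q i ^ 2) := by
    intro i
    rw [lintegral_const_mul _ ((hf i).enorm.pow_const 2)]
    have h1 : ∫⁻ y, ‖f i y‖ₑ ^ 2 ∂μ = eLpNorm (f i) 2 μ ^ 2 := by
      have := eLpNorm_nnreal_pow_eq_lintegral (f := f i) (μ := μ) (p := 2) (by norm_num)
      simpa using this.symm
    rw [h1]
    calc _ ≤ ENNReal.ofReal ((q i / c i) ^ 2) * ENNReal.ofReal (c i) ^ 2 := by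
          gcongr; exact hb i
      _ = _ := by
          rw [← ENNReal.ofReal_pow (hc i).le, ← ENNReal.ofReal_mul (by positivity)]
          congr 1
          have := (hc i).ne'
          field_simp
  have hfin : ∫⁻ y, ∑' i, g i y ∂μ ≠ ⊤ := by
    rw [lintegral_tsum (fun i => (hg i).aemeasurable)]
    refine ne_top_of_le_ne_top ?_ (ENNReal.tsum_le_tsum hint)
    exact hs.tsum_ofReal_ne_top
  filter_upwards [ae_lt_top (Measurable.tsum hg) hfin] with y hy
  refine ⟨Real.sqrt (∑' i, g i y).toReal + 1, by positivity, fun i => ?_⟩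
  have h1 : g i y ≤ ∑' i, g i y := ENNReal.le_tsum i
  have h2 := ENNReal.toReal_mono hy.ne h1
  have h3 : (g i y).toReal = (q i / c i * |f i y|) ^ 2 := by
    simp only [g, ENNReal.toReal_mul, ENNReal.toReal_pow, toReal_enorm, Real.norm_eq_abs]
    rw [ENNReal.toReal_ofReal (by positivity), mul_pow]
  rw [h3] at h2
  have h4 := Real.le_sqrt_of_sq_le h2
  have h5 : q i / c i * |f i y| = |f i y| * q i / c i := by ring
  rw [h5, div_le_iff₀ (hc i)] at h4
  have := hc i
  nlinarith


noncomputable def schPhi {G : Type*} [Group G] (Γ : Subgroup G) (A : Set G) (y : G) : ENNReal :=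
  ∑' γ : Γ, A.indicator (fun _ => (1 : ENNReal)) (y * γ)

theorem schPhi_mul {G : Type*} [Group G] (Γ : Subgroup G) (A : Set G) (y : G) (γ : Γ) :
    schPhi Γ A (y * γ) = schPhi Γ A y := by
  unfold schPhi
  rw [← (Equiv.mulLeft γ).tsum_eq (fun δ : Γ => A.indicator (fun _ => (1 : ENNReal)) (y * δ))]
  simp [mul_assoc]

noncomputable def schPhiQ {G : Type*} [Group G] (Γ : Subgroup G) (A : Set G) :
    G ⧸ Γ → ENNReal :=
  Quotient.lift (schPhi Γ A) (by
    intro x y hxy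
    have h : x⁻¹ * y ∈ Γ := QuotientGroup.leftRel_apply.1 hxy
    have := schPhi_mul Γ A x ⟨_, h⟩
    simpa using this.symm)

theorem schPhiQ_mk {G : Type*} [Group G] (Γ : Subgroup G) (A : Set G) (y : G) :
    schPhiQ Γ A (QuotientGroup.mk y) = schPhi Γ A y := rfl

theorem sch_finite {G : Type*} [Group G] [TopologicalSpace G] [IsTopologicalGroup G] [T2Space G]
    (Γ : Subgroup G) [hd : DiscreteTopology Γ] (A : Set G) (hA : IsCompact A) :
    {γ : Γ | (γ : G) ∈ A}.Finite := by
  have := Γ.tendsto_coe_cofinite_of_discrete (SetLike.isDiscrete_iff_discreteTopology.2 hd)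
  have h2 := this hA.compl_mem_cocompact
  rw [Filter.mem_map, Filter.mem_cofinite] at h2
  refine h2.subset fun γ hγ => ?_
  simpa using hγ

theorem sch_tsum_ind {ι : Type*} (s : Set ι) :
    ∑' i, s.indicator (fun _ => (1 : ENNReal)) i = s.encard := by
  rw [← tsum_subtype, ENNReal.tsum_set_one]

open Pointwise in
theorem sch_bound {G : Type*} [Group G] [TopologicalSpace G] [IsTopologicalGroup G] [T2Space G]
    (Γ : Subgroup G) [DiscreteTopology Γ] (A1 : Set G) (hA : IsCompact A1) :
    ∃ M : ℕ, 0 < M ∧ ∀ A ⊆ A1, ∀ y, schPhi Γ A y ≤ M := by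
  have hfin := sch_finite Γ (A1⁻¹ * A1) (hA.inv.mul hA)
  refine ⟨_ + 1, Nat.succ_pos {γ : Γ | (γ : G) ∈ A1⁻¹ * A1}.ncard, fun A hAA y => ?_⟩
  by_cases h : ∃ γ : Γ, y * γ ∈ A
  · obtain ⟨γ, hγ⟩ := h
    rw [← schPhi_mul Γ A y γ]
    have h1 : schPhi Γ A (y * γ) ≤
        ∑' δ : Γ, {γ : Γ | (γ : G) ∈ A1⁻¹ * A1}.indicator (fun _ => (1 : ENNReal)) δ := by
      refine ENNReal.tsum_le_tsum fun δ => ?_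
      by_cases hδ : y * γ * δ ∈ A
      · have : δ ∈ {γ : Γ | (γ : G) ∈ A1⁻¹ * A1} :=
          ⟨(y * γ)⁻¹, Set.inv_mem_inv.2 (hAA hγ), _, hAA hδ, by group⟩
        rw [Set.indicator_of_mem this, Set.indicator_of_mem hδ]
      · rw [Set.indicator_of_notMem hδ]; exact zero_le
    refine h1.trans ?_
    rw [sch_tsum_ind, ← hfin.cast_ncard_eq]
    simp
  · have : schPhi Γ A y = 0 := by
      unfold schPhi
      refine ENNReal.tsum_eq_zero.2 fun γ => Set.indicator_of_notMem (fun hh => h ⟨γ, hh⟩) _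
    rw [this]; exact zero_le

set_option linter.unusedSectionVars false
section
variable {G : Type*} [Group G] [TopologicalSpace G] [IsTopologicalGroup G] [T2Space G]
  [SecondCountableTopology G] [MeasurableSpace G] [BorelSpace G]
  (Γ : Subgroup G) [DiscreteTopology Γ]

theorem sch_countable : Countable Γ := countable_of_Lindelof_of_discrete

theorem schPhi_measurable (A : Set G) (hA : MeasurableSet A) : Measurable (schPhi Γ A) := by
  have := sch_countable Γ
  unfold schPhi
  refine Measurable.tsum fun γ => ?_
  exact (measurable_const.indicator hA).comp (measurable_mul_const _)

theorem schPhiQ_measurable (A : Set G) (hA : MeasurableSet A) : Measurable (schPhiQ Γ A) :=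
  QuotientGroup.measurable_from_quotient.2 (schPhi_measurable Γ A hA)

theorem sch_mk_measurable : Measurable (QuotientGroup.mk : G → G ⧸ Γ) :=
  QuotientGroup.measurable_coe

theorem schPhi_lintegral (m : Measure G) [m.IsMulRightInvariant] (F : Set G)
    (hF : IsFundamentalDomain Γ.op F m) (A : Set G) (hA : MeasurableSet A) :
    ∫⁻ y in F, schPhi Γ A y ∂m = m A := by
  have := sch_countable Γ
  have : Countable Γ.op := (Subgroup.equivOp Γ).symm.injective.countable
  unfold schPhi
  have hm : ∀ γ : Γ, AEMeasurable
      (fun y : G => A.indicator (fun _ => (1 : ENNReal)) (y * γ)) (m.restrict F) := fun γ =>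
    ((measurable_const.indicator hA).comp (measurable_mul_const (γ : G))).aemeasurable
  rw [lintegral_tsum hm]
  rw [← lintegral_indicator_one hA, hF.lintegral_eq_tsum'',
    ← (Subgroup.equivOp Γ).tsum_eq]
  rfl

theorem sch_ae_pull (m : Measure G) [m.IsMulRightInvariant] (F : Set G)
    (hF : IsFundamentalDomain Γ.op F m) (p : G ⧸ Γ → Prop)
    (hp : ∀ᵐ z ∂(Measure.map (QuotientGroup.mk : G → G ⧸ Γ) (m.restrict F)), p z) :
    ∀ᵐ y ∂m, p (QuotientGroup.mk y) := by
  have := sch_countable Γ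
  have : Countable Γ.op := (Subgroup.equivOp Γ).symm.injective.countable
  have h1 := ae_of_ae_map (sch_mk_measurable Γ).aemeasurable hp
  rw [ae_iff] at h1 ⊢
  refine hF.measure_zero_of_invariant _ ?_ ?_
  · intro g
    have hmk : ∀ (g : Γ.op) (y : G), (QuotientGroup.mk (g • y) : G ⧸ Γ) = QuotientGroup.mk y := by
      intro g y
      exact (QuotientGroup.mk_mul_of_mem y (g.2 : _) : _)
    ext y
    rw [Set.mem_smul_set_iff_inv_smul_mem]
    simp only [Set.mem_ofPred_eq, hmk]
  · rwa [Measure.restrict_apply₀' hF.nullMeasurableSet] at h1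
end

theorem sch_L2 {α : Type*} [MeasurableSpace α] (μ : Measure α) (Φ : α → ENNReal)
    (M β : ℝ) (hM : 0 ≤ M) (hβ : 0 ≤ β) (hΦ : ∀ y, Φ y ≤ ENNReal.ofReal M)
    (hm : Measurable Φ) (hint : ∫⁻ y, Φ y ∂μ = ENNReal.ofReal β) :
    eLpNorm (fun y => (Φ y).toReal) 2 μ ≤ ENNReal.ofReal (Real.sqrt (M * β)) := by
  have h1 : ∫⁻ y, ‖(Φ y).toReal‖ₑ ^ 2 ∂μ = eLpNorm (fun y => (Φ y).toReal) 2 μ ^ 2 := by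
    have := eLpNorm_nnreal_pow_eq_lintegral (f := fun y => (Φ y).toReal) (μ := μ) (p := 2)
      (by norm_num)
    simpa using this.symm
  rw [← ENNReal.pow_le_pow_left_iff two_ne_zero, ← h1, ← ENNReal.ofReal_pow (Real.sqrt_nonneg _),
    Real.sq_sqrt (by positivity), ENNReal.ofReal_mul hM, ← hint, ← lintegral_const_mul _ hm]
  refine lintegral_mono fun y => ?_
  have h2 : ‖(Φ y).toReal‖ₑ = Φ y := by
    rw [Real.enorm_eq_ofReal ENNReal.toReal_nonneg,
      ENNReal.ofReal_toReal (ne_top_of_le_ne_top ENNReal.ofReal_ne_top (hΦ y))]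
  show ‖(Φ y).toReal‖ₑ ^ 2 ≤ _
  rw [h2, sq]
  gcongr
  exact hΦ y

theorem sch_sphere {G1 : Type*} [Group G1] [MetricSpace G1] [IsTopologicalGroup G1]
    [SecondCountableTopology G1] [MeasurableSpace G1] [BorelSpace G1]
    (hrt : ∀ x y g : G1, dist (x * g) (y * g) = dist x y)
    {G2 : Type*} [Group G2] [TopologicalSpace G2] [IsTopologicalGroup G2]
    [SecondCountableTopology G2] [T2Space G2]
    [MeasurableSpace G2] [BorelSpace G2]
    (m2 : Measure G2) [m2.IsMulRightInvariant]
    (K : Subgroup G2) (hKo : IsOpen (K : Set G2)) (hK1 : m2 (K : Set G2) = 1)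
    (Γ : Subgroup (G1 × G2)) [DiscreteTopology Γ]
    (H : G2 → ℕ) (hHbi : ∀ u ∈ K, ∀ v ∈ K, ∀ g : G2, H (u * g * v) = H g)
    (h : ℕ) (hSm : MeasurableSet (H ⁻¹' {h})) (r : ℝ) (x : G1) (u : G2) (hu : u ∈ K) :
    ∫⁻ s in H ⁻¹' {h}, schPhi Γ (Metric.closedBall (1 : G1) r ×ˢ (K : Set G2)) (x, s * u) ∂m2 =
      {γ : Γ | dist x (γ : G1 × G2).1 ≤ r ∧ H (γ : G1 × G2).2 = h}.encard := by
  have := sch_countable Γ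
  have hA : MeasurableSet (Metric.closedBall (1 : G1) r ×ˢ (K : Set G2)) :=
    measurableSet_closedBall.prod hKo.measurableSet
  unfold schPhi
  have hm : ∀ γ : Γ, AEMeasurable (fun s : G2 =>
      (Metric.closedBall (1 : G1) r ×ˢ (K : Set G2)).indicator (fun _ => (1 : ENNReal))
        ((x, s * u) * (γ : G1 × G2))) (m2.restrict (H ⁻¹' {h})) := fun γ => by
    refine ((measurable_const.indicator hA).comp ?_).aemeasurable
    exact (Measurable.prodMk measurable_const (measurable_mul_const u)).mul_const _
  rw [lintegral_tsum hm, ← sch_tsum_ind, ← (Equiv.inv Γ).tsum_eq]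
  refine tsum_congr fun γ => ?_
  set g1 := (γ : G1 × G2).1 with hg1
  set g2 := (γ : G1 × G2).2 with hg2
  have hdist : dist (x * g1⁻¹) 1 = dist x g1 := by
    have := hrt (x * g1⁻¹) 1 g1
    rw [← this]; simp
  have hmem : ∀ s : G2, ((x, s * u) * ((Equiv.inv Γ γ : Γ) : G1 × G2)) ∈
      (Metric.closedBall (1 : G1) r ×ˢ (K : Set G2)) ↔ dist x g1 ≤ r ∧ s * (u * g2⁻¹) ∈ K := by
    intro s
    rw [← hdist]
    simp [Set.mem_prod, hg1, hg2, mul_assoc]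
  have hHs : ∀ s : G2, s * (u * g2⁻¹) ∈ K → H s = H g2 := by
    intro s hs
    have := hHbi _ hs _ (K.inv_mem hu) g2
    rw [← this]; congr 1; group
  by_cases hc : dist x g1 ≤ r ∧ H g2 = h
  · have hc' : γ ∈ {γ : Γ | dist x (γ : G1 × G2).1 ≤ r ∧ H (γ : G1 × G2).2 = h} := hc
    have hmu := (measure_preimage_mul_right m2 (u * g2⁻¹) (K : Set G2)).trans hK1
    rw [Set.indicator_of_mem hc']
    have hms : MeasurableSet ((fun s => s * (u * g2⁻¹)) ⁻¹' (K : Set G2)) :=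
      measurable_mul_const _ hKo.measurableSet
    have hfun : ∀ s : G2, (Metric.closedBall (1 : G1) r ×ˢ (K : Set G2)).indicator
        (fun _ => (1 : ENNReal)) ((x, s * u) * ((Equiv.inv Γ γ : Γ) : G1 × G2)) =
        ((fun s => s * (u * g2⁻¹)) ⁻¹' (K : Set G2)).indicator 1 s := by
      intro s
      by_cases hs : s * (u * g2⁻¹) ∈ K
      · rw [Set.indicator_of_mem ((hmem s).2 ⟨hc.1, hs⟩), Set.indicator_of_mem (by exact hs)]; rfl
      · rw [Set.indicator_of_notMem (fun hh => hs ((hmem s).1 hh).2),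
          Set.indicator_of_notMem (by exact hs)]
    rw [lintegral_congr hfun, lintegral_indicator_one hms, Measure.restrict_apply hms]
    rw [Set.inter_eq_left.2, hmu]
    intro s hs
    exact (hHs s hs).trans hc.2
  · have hc' : γ ∉ {γ : Γ | dist x (γ : G1 × G2).1 ≤ r ∧ H (γ : G1 × G2).2 = h} := hc
    rw [Set.indicator_of_notMem hc', setLIntegral_congr_fun hSm (g := fun _ => 0)]
    · simp
    · intro s hs
      refine Set.indicator_of_notMem (fun hh => hc ?_) _
      obtain ⟨h1, h2⟩ := (hmem s).1 hh
      exact ⟨h1, (hHs s h2).symm.trans hs⟩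

theorem sch_card_sum {ι : Type*} (P : ι → ℕ → Prop) (Hf : ι → ℕ) (T : ℕ) (h1 : ∀ i, 1 ≤ Hf i)
    (hfin : {i | P i (Hf i) ∧ Hf i ≤ T}.Finite) :
    Nat.card {i // P i (Hf i) ∧ Hf i ≤ T} =
      ∑ h ∈ Finset.Icc 1 T, {i | P i h ∧ Hf i = h}.ncard := by
  classical
  have e1 : Nat.card {i // P i (Hf i) ∧ Hf i ≤ T} = hfin.toFinset.card := by
    rw [← Set.ncard_coe_finset, hfin.coe_toFinset]; rfl
  rw [e1, Finset.card_eq_sum_card_fiberwise (f := Hf) (t := Finset.Icc 1 T)]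
  · refine Finset.sum_congr rfl fun h hh => ?_
    rw [← Set.ncard_coe_finset]
    congr 1
    ext i
    have := (Finset.mem_Icc.1 hh).2
    simp only [Finset.coe_filter, Set.Finite.mem_toFinset, Set.mem_ofPred_eq]
    constructor
    · rintro ⟨⟨a, b⟩, rfl⟩; exact ⟨a, rfl⟩
    · rintro ⟨a, rfl⟩; exact ⟨⟨a, this⟩, rfl⟩
  · intro i hi
    have : P i (Hf i) ∧ Hf i ≤ T := by simpa using hi
    simpa using ⟨h1 i, this.2⟩


/-- The measure-theoretic form of the paper's Corollary 3.3 ('cor_NT'): under the same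
hypotheses as the mean-square theorem, for every `θ' ∈ (θ0, 1)` and almost every
`x ∈ G1` there is a constant `C_x` with `|N_T(x) − V_T| ≤ C_x · V_T^{θ'}` for all
`T ≥ 1`. -/
theorem schmidt_almost_everywhere
    {G1 : Type*} [Group G1] [MetricSpace G1] [IsTopologicalGroup G1]
    [SecondCountableTopology G1] [ProperSpace G1] [LocallyCompactSpace G1]
    [MeasurableSpace G1] [BorelSpace G1]
    (m1 : Measure G1) [m1.IsHaarMeasure] [m1.IsMulRightInvariant]
    (hrt : ∀ x y g : G1, dist (x * g) (y * g) = dist x y)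
    (d c1 c2 : ℝ) (hd : 0 < d) (hc1 : 0 < c1) (hc12 : c1 ≤ c2)
    (hball : ∀ r : ℝ, 0 < r → r ≤ 1 →
      ENNReal.ofReal (c1 * r ^ d) ≤ m1 (Metric.closedBall (1 : G1) r) ∧
        m1 (Metric.closedBall (1 : G1) r) ≤ ENNReal.ofReal (c2 * r ^ d))
    {G2 : Type*} [Group G2] [TopologicalSpace G2] [IsTopologicalGroup G2]
    [LocallyCompactSpace G2] [SecondCountableTopology G2] [T2Space G2]
    [MeasurableSpace G2] [BorelSpace G2]
    (m2 : Measure G2) [m2.IsHaarMeasure] [m2.IsMulRightInvariant]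
    (K : Subgroup G2) (hKc : IsCompact (K : Set G2)) (hKo : IsOpen (K : Set G2))
    (hK1 : m2 (K : Set G2) = 1)
    (Γ : Subgroup (G1 × G2)) [DiscreteTopology Γ]
    (F : Set (G1 × G2))
    (hF : IsFundamentalDomain Γ.op F (m1.prod m2))
    (hFvol : (m1.prod m2) F = 1)
    (μ : Measure ((G1 × G2) ⧸ Γ))
    (hμ : μ = Measure.map (QuotientGroup.mk : G1 × G2 → (G1 × G2) ⧸ Γ)
      ((m1.prod m2).restrict F))
    (H : G2 → ℕ) (hH1 : ∀ g, 1 ≤ H g)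
    (hHbi : ∀ u ∈ K, ∀ v ∈ K, ∀ g : G2, H (u * g * v) = H g)
    (hHcpt : ∀ h : ℕ, IsCompact (H ⁻¹' {h}))
    -- (V1): volume lower bound for the nonempty height spheres
    (ca a : ℝ) (hca : 0 < ca) (ha : 0 < a)
    (hV1 : ∀ h : ℕ, 0 < m2 (H ⁻¹' {h}) →
      ENNReal.ofReal (ca * (h : ℝ) ^ a) ≤ m2 (H ⁻¹' {h}))
    -- (C): counting bound for the set of heights
    (hC : ∀ η : ℝ, 0 < η → ∃ Cη : ℝ, 0 < Cη ∧ ∀ T : ℕ, 1 ≤ T →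
      (({h : ℕ | 0 < m2 (H ⁻¹' {h})} ∩ Set.Icc 1 T).ncard : ℝ) ≤ Cη * (T : ℝ) ^ η)
    -- (G): bounded multiplicative gaps for the set of heights
    (hG : ∃ Δ : ℝ, 1 ≤ Δ ∧ ∃ T1 : ℝ, ∀ T : ℝ, T1 ≤ T →
      ∃ h : ℕ, 0 < m2 (H ⁻¹' {h}) ∧ T / Δ ≤ (h : ℝ) ∧ (h : ℝ) ≤ T)
    -- (SP): effective mean ergodic theorem for the height-sphere averages
    (k Csp : ℝ) (hk0 : 0 < k) (hk : k < 1 / 2) (hCsp : 0 < Csp)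
    (hSP : ∀ h : ℕ, 0 < m2 (H ⁻¹' {h}) → ∀ φ : (G1 × G2) ⧸ Γ → ℝ, MemLp φ 2 μ →
      eLpNorm (fun y => ((m2 (H ⁻¹' {h})).toReal)⁻¹ *
          (∫ s in H ⁻¹' {h}, φ (((1 : G1), s) • y) ∂m2) - ∫ z, φ z ∂μ) 2 μ ≤
        ENNReal.ofReal (Csp * (m2 (H ⁻¹' {h})).toReal ^ (-k)) * eLpNorm φ 2 μ)
    (b : ℝ) (hb0 : 0 < b) (hb : b < 2 * a * k / d)
    (θ' : ℝ) (hθ0 : ((1 - k) * a - b * d / 2) / (a - b * d) < θ') (hθ1 : θ' < 1) :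
    ∀ᵐ x ∂m1, ∃ Cx : ℝ, 0 < Cx ∧ ∀ T : ℕ, 1 ≤ T →
      |(Nat.card {γ : Γ //
            dist x (γ : G1 × G2).1 ≤ ((H (γ : G1 × G2).2 : ℝ)) ^ (-b) ∧
              H (γ : G1 × G2).2 ≤ T} : ℝ) -
          ∑ h ∈ Finset.Icc 1 T,
            (m1 (Metric.closedBall (1 : G1) ((h : ℝ) ^ (-b)))).toReal *
              (m2 (H ⁻¹' {h})).toReal| ≤
        Cx * (∑ h ∈ Finset.Icc 1 T,
            (m1 (Metric.closedBall (1 : G1) ((h : ℝ) ^ (-b)))).toReal *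
              (m2 (H ⁻¹' {h})).toReal) ^ θ' := by
  classical
  have hbd : b * d < 2 * a * k := by rwa [lt_div_iff₀ hd] at hb
  have hak : 2 * a * k < a := by nlinarith
  have habd : 0 < a - b * d := by linarith
  have hθ : 1 - k ≤ θ' := by
    refine le_trans ?_ hθ0.le
    rw [le_div_iff₀ habd]
    nlinarith [mul_pos hb0 hd]
  set δ : ℝ := θ' * (a - b * d) - ((1 - k) * a - b * d / 2) with hδ
  have hδ0 : 0 < δ := by
    rw [div_lt_iff₀ habd] at hθ0
    linarith
  -- basic quantities
  set S : Set ℕ := {h : ℕ | 0 < m2 (H ⁻¹' {h})} with hS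
  set β : ℕ → ℝ := fun h => (m1 (Metric.closedBall (1 : G1) ((h : ℝ) ^ (-b)))).toReal with hβ
  set m : ℕ → ℝ := fun h => (m2 (H ⁻¹' {h})).toReal with hm
  have hSm : ∀ h, MeasurableSet (H ⁻¹' {h}) := fun h => (hHcpt h).measurableSet
  have hmfin : ∀ h, m2 (H ⁻¹' {h}) ≠ ⊤ := fun h => (hHcpt h).measure_lt_top.ne
  have hβfin : ∀ h : ℕ, m1 (Metric.closedBall (1 : G1) ((h : ℝ) ^ (-b))) ≠ ⊤ :=
    fun h => (isCompact_closedBall _ _).measure_lt_top.ne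
  have hS1 : ∀ h ∈ S, 1 ≤ h := by
    intro h hh
    by_contra h0
    have h0 : h = 0 := by omega
    have : H ⁻¹' {h} = ∅ := by
      ext g
      have := hH1 g
      simp [h0]; omega
    simp [hS, this] at hh
  have hr0 : ∀ h : ℕ, 1 ≤ h → 0 < (h : ℝ) ^ (-b) := fun h hh => by
    have : (0 : ℝ) < h := by exact_mod_cast hh
    positivity
  have hr1 : ∀ h : ℕ, 1 ≤ h → (h : ℝ) ^ (-b) ≤ 1 := fun h hh =>
    Real.rpow_le_one_of_one_le_of_nonpos (by exact_mod_cast hh) (by linarith)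
  have hβlow : ∀ h : ℕ, 1 ≤ h → c1 * ((h : ℝ) ^ (-b)) ^ d ≤ β h := fun h hh =>
    (ENNReal.ofReal_le_iff_le_toReal (hβfin h)).1 (hball _ (hr0 h hh) (hr1 h hh)).1
  have hβpos : ∀ h : ℕ, 1 ≤ h → 0 < β h := fun h hh => by
    have := hr0 h hh
    exact lt_of_lt_of_le (by positivity) (hβlow h hh)
  have hmlow : ∀ h ∈ S, ca * (h : ℝ) ^ a ≤ m h := fun h hh =>
    (ENNReal.ofReal_le_iff_le_toReal (hmfin h)).1 (hV1 h hh)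
  have hmpos : ∀ h ∈ S, 0 < m h := fun h hh => ENNReal.toReal_pos hh.ne' (hmfin h)
  have hmS : ∀ h, h ∉ S → m h = 0 := by
    intro h hh
    have : m2 (H ⁻¹' {h}) = 0 := by simpa [hS] using hh
    simp [hm, this]
  -- the counting function on spheres
  set N : G1 → ℕ → ℕ := fun x h =>
    {γ : Γ | dist x (γ : G1 × G2).1 ≤ (h : ℝ) ^ (-b) ∧ H (γ : G1 × G2).2 = h}.ncard with hN
  have hNS : ∀ x h, h ∉ S → N x h = 0 := by
    intro x h hh
    have h0 : m2 (H ⁻¹' {h}) = 0 := by simpa [hS] using hh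
    have : {γ : Γ | dist x (γ : G1 × G2).1 ≤ (h : ℝ) ^ (-b) ∧ H (γ : G1 × G2).2 = h} = ∅ := by
      refine Set.eq_empty_iff_forall_notMem.2 fun γ hγ => ?_
      have hsub : (fun s => s * ((γ : G1 × G2).2)⁻¹) ⁻¹' (K : Set G2) ⊆ H ⁻¹' {h} := by
        intro s hs
        have h3 := hHbi _ hs 1 K.one_mem (γ : G1 × G2).2
        have h4 : s * ((γ : G1 × G2).2)⁻¹ * (γ : G1 × G2).2 * 1 = s := by group
        rw [h4] at h3
        exact h3.trans hγ.2
      have := measure_mono_null hsub h0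
      rw [measure_preimage_mul_right, hK1] at this
      exact one_ne_zero this
    simp [hN, this]
  have hcard : ∀ x T, (Nat.card {γ : Γ //
            dist x (γ : G1 × G2).1 ≤ ((H (γ : G1 × G2).2 : ℝ)) ^ (-b) ∧
              H (γ : G1 × G2).2 ≤ T}) = ∑ h ∈ Finset.Icc 1 T, N x h := by
    intro x T
    refine sch_card_sum (fun (γ : Γ) h => dist x (γ : G1 × G2).1 ≤ (h : ℝ) ^ (-b))
      (fun γ => H (γ : G1 × G2).2) T (fun γ => hH1 _) ?_
    refine (sch_finite Γ (Metric.closedBall x 1 ×ˢ (⋃ h ∈ Finset.Icc 1 T, H ⁻¹' {h}))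
      ((isCompact_closedBall _ _).prod
        ((Finset.Icc 1 T).isCompact_biUnion fun h _ => hHcpt h))).subset ?_
    rintro γ ⟨h1, h2⟩
    refine ⟨?_, ?_⟩
    · rw [Metric.mem_closedBall, dist_comm]
      exact h1.trans (hr1 _ (hH1 _))
    · simp only [Set.mem_iUnion]
      exact ⟨_, Finset.mem_Icc.2 ⟨hH1 _, h2⟩, rfl⟩
  -- the probability measure
  have hμ1 : IsProbabilityMeasure μ := by
    refine ⟨?_⟩
    rw [hμ, Measure.map_apply (sch_mk_measurable Γ) MeasurableSet.univ]
    simpa using hFvol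
  -- the functions
  set A : ℕ → Set (G1 × G2) := fun h =>
    Metric.closedBall (1 : G1) ((h : ℝ) ^ (-b)) ×ˢ (K : Set G2) with hA
  have hAm : ∀ h, MeasurableSet (A h) := fun h =>
    measurableSet_closedBall.prod hKo.measurableSet
  obtain ⟨M, hM0, hM⟩ := sch_bound Γ (Metric.closedBall (1 : G1) 1 ×ˢ (K : Set G2))
    ((isCompact_closedBall _ _).prod hKc)
  have hMh : ∀ h ∈ S, ∀ y, schPhi Γ (A h) y ≤ M := fun h hh => hM _
    (Set.prod_mono (Metric.closedBall_subset_closedBall (hr1 h (hS1 h hh))) subset_rfl)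
  have hMr : (0 : ℝ) < M := by exact_mod_cast hM0
  have hQle : ∀ h ∈ S, ∀ z, schPhiQ Γ (A h) z ≤ ENNReal.ofReal M := by
    intro h hh z
    obtain ⟨y, rfl⟩ := QuotientGroup.mk_surjective z
    rw [schPhiQ_mk, ENNReal.ofReal_natCast]
    exact hMh h hh y
  have hQm : ∀ h, Measurable (schPhiQ Γ (A h)) := fun h => schPhiQ_measurable Γ _ (hAm h)
  have hQint : ∀ h, ∫⁻ z, schPhiQ Γ (A h) z ∂μ = ENNReal.ofReal (β h) := by
    intro h
    rw [hμ, lintegral_map (hQm h) (sch_mk_measurable Γ)]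
    simp only [schPhiQ_mk]
    rw [schPhi_lintegral Γ _ F hF _ (hAm h), Measure.prod_prod, hK1, mul_one,
      ENNReal.ofReal_toReal (hβfin h)]
  have hL2 : ∀ h ∈ S, eLpNorm (fun z => (schPhiQ Γ (A h) z).toReal) 2 μ ≤
      ENNReal.ofReal (Real.sqrt (M * β h)) := fun h hh =>
    sch_L2 μ _ M (β h) hMr.le (hβpos h (hS1 h hh)).le (hQle h hh) (hQm h) (hQint h)
  have hmem : ∀ h ∈ S, MemLp (fun z => (schPhiQ Γ (A h) z).toReal) 2 μ := fun h hh =>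
    ⟨(hQm h).ennreal_toReal.aestronglyMeasurable, (hL2 h hh).trans_lt ENNReal.ofReal_lt_top⟩
  have hInt : ∀ h ∈ S, ∫ z, (schPhiQ Γ (A h) z).toReal ∂μ = β h := by
    intro h hh
    rw [integral_toReal (hQm h).aemeasurable
      (Filter.Eventually.of_forall fun z => (hQle h hh z).trans_lt ENNReal.ofReal_lt_top), hQint,
      ENNReal.toReal_ofReal (hβpos h (hS1 h hh)).le]
  let f : S → (G1 × G2) ⧸ Γ → ℝ := fun h y => ((m2 (H ⁻¹' {(h : ℕ)})).toReal)⁻¹ *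
          (∫ s in H ⁻¹' {(h : ℕ)}, (schPhiQ Γ (A h) (((1 : G1), s) • y)).toReal ∂m2) -
            ∫ z, (schPhiQ Γ (A h) z).toReal ∂μ
  have hfm : ∀ h, Measurable (f h) := by
    intro h
    refine QuotientGroup.measurable_from_quotient.2 ?_
    refine Measurable.sub_const (Measurable.const_mul ?_ _) _
    have h1 : Measurable (fun q : (G1 × G2) × G2 =>
        (schPhi Γ (A h) (((1 : G1), q.2) * q.1)).toReal) := by
      refine ((schPhi_measurable Γ _ (hAm h)).comp ?_).ennreal_toReal
      exact (Measurable.prodMk measurable_const measurable_snd).mul measurable_fst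
    exact (h1.stronglyMeasurable.integral_prod_right'
      (ν := m2.restrict (H ⁻¹' {(h : ℕ)}))).measurable
  have hfval : ∀ (h : S) (x : G1) (u : G2), u ∈ K →
      f h (QuotientGroup.mk (x, u)) = (m h)⁻¹ * (N x h : ℝ) - β h := by
    intro h x u hu
    have h1 : ∫ s in H ⁻¹' {(h : ℕ)},
        (schPhiQ Γ (A h) (((1 : G1), s) • (QuotientGroup.mk (x, u) : (G1 × G2) ⧸ Γ))).toReal ∂m2 =
        ∫ s in H ⁻¹' {(h : ℕ)}, (schPhi Γ (A h) (x, s * u)).toReal ∂m2 := by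
      congr 1
      ext s
      have : (((1 : G1), s) • (QuotientGroup.mk (x, u) : (G1 × G2) ⧸ Γ)) =
        QuotientGroup.mk (((1 : G1), s) * (x, u)) := rfl
      rw [this, schPhiQ_mk, Prod.mk_mul_mk, one_mul]
    have h2 : ∫ s in H ⁻¹' {(h : ℕ)}, (schPhi Γ (A h) (x, s * u)).toReal ∂m2 = N x h := by
      rw [integral_toReal]
      · rw [sch_sphere hrt m2 K hKo hK1 Γ H hHbi h (hSm h) _ x u hu]
        simp only [hN, Set.ncard]
        generalize Set.encard _ = e
        cases e <;> simp
      · exact ((schPhi_measurable Γ _ (hAm h)).comp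
          (Measurable.prodMk measurable_const (measurable_mul_const u))).aemeasurable
      · exact Filter.Eventually.of_forall fun s =>
          (hMh h h.2 _).trans_lt (ENNReal.natCast_lt_top M)
    simp only [f]
    rw [h1, h2, hInt h h.2]
  have hsum : Summable (fun h : S => ((h : ℕ) : ℝ) ^ (-(δ / 2))) :=
    sch_summable S (fun h0 => by have := hS1 0 h0; omega) hC _ (by positivity)
  have hsum2 : Summable (fun h : S => (((h : ℕ) : ℝ) ^ (-(δ / 2))) ^ 2) := by
    have := sch_summable S (fun h0 => by have := hS1 0 h0; omega) hC δ hδ0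
    refine this.congr fun h => ?_
    rw [← Real.rpow_natCast, ← Real.rpow_mul (by positivity)]
    congr 1; push_cast; ring
  have hae := sch_bc μ f hfm (fun h => Csp * (m h) ^ (-k) * Real.sqrt (M * β h))
    (fun h : S => ((h : ℕ) : ℝ) ^ (-(δ / 2)))
    (fun h => by
      have := hmpos h h.2
      have := hβpos h (hS1 h h.2)
      positivity) hsum2 (fun h => by
      refine (hSP h h.2 _ (hmem h h.2)).trans ?_
      have := hmpos h h.2
      rw [ENNReal.ofReal_mul (p := Csp * (m h) ^ (-k)) (by positivity)]
      exact mul_le_mul' le_rfl (hL2 h h.2))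
  rw [hμ] at hae
  have hae2 := Measure.ae_ae_of_ae_prod (sch_ae_pull Γ (m1.prod m2) F hF _ hae)
  obtain ⟨C0, hC0, hineq⟩ := sch_ineq k a b d θ' ca c1 hk hca hc1 hθ
  filter_upwards [hae2] with x hx
  obtain ⟨u, hu, C, hCpos, hCx⟩ : ∃ u ∈ K, ∃ C : ℝ, 0 < C ∧ ∀ h : S,
      |f h (QuotientGroup.mk (x, u))| * ((h : ℕ) : ℝ) ^ (-(δ / 2)) ≤
        C * (Csp * (m h) ^ (-k) * Real.sqrt (M * β h)) := by
    by_contra hcon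
    push Not at hcon
    have : m2 (K : Set G2) = 0 := by
      refine measure_mono_null (fun u hu => ?_) (ae_iff.1 hx)
      rintro ⟨C, hC, hh⟩
      obtain ⟨h, hlt⟩ := hcon u hu C hC
      exact absurd (hh h) (not_le.2 hlt)
    rw [hK1] at this
    exact one_ne_zero this
  set D : ℝ := C * Csp * Real.sqrt M * C0 with hD
  have hMs : 0 < Real.sqrt M := Real.sqrt_pos.2 hMr
  have hD0 : 0 < D := by positivity
  have hterm : ∀ h : S, |(N x h : ℝ) - β h * m h| ≤
      D * (β h * m h) ^ θ' * ((h : ℕ) : ℝ) ^ (-(δ / 2)) := by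
    intro h
    have hm0 := hmpos h h.2
    have hβ0 := hβpos h (hS1 h h.2)
    have hh1 : (1 : ℝ) ≤ (h : ℕ) := by exact_mod_cast hS1 h h.2
    have hh0 : (0 : ℝ) < (h : ℕ) := by linarith
    have h1 := hCx h
    rw [hfval h x u hu] at h1
    have h2 : |(N x h : ℝ) - β h * m h| = m h * |(m h)⁻¹ * (N x h : ℝ) - β h| := by
      rw [← abs_of_pos hm0, ← abs_mul, abs_of_pos hm0]
      congr 1
      field_simp
    have h3 := hineq (h : ℕ) (m h) (β h) hh1 (hmlow h h.2) (hβlow h (hS1 h h.2))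
    rw [← hδ] at h3
    have h4 : m h * (C * (Csp * (m h) ^ (-k) * Real.sqrt (M * β h))) =
        C * Csp * Real.sqrt M * ((m h) ^ (1 - k) * (β h) ^ (1 / 2 : ℝ)) := by
      rw [Real.sqrt_mul hMr.le, ← Real.sqrt_eq_rpow, sub_eq_add_neg, Real.rpow_add hm0,
        Real.rpow_one]
      ring
    have hq : 0 < ((h : ℕ) : ℝ) ^ (-(δ / 2)) := by positivity
    refine le_of_mul_le_mul_right ?_ hq
    calc |(N x h : ℝ) - β h * m h| * ((h : ℕ) : ℝ) ^ (-(δ / 2))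
        = m h * (|(m h)⁻¹ * (N x h : ℝ) - β h| * ((h : ℕ) : ℝ) ^ (-(δ / 2))) := by
          rw [h2]; ring
      _ ≤ m h * (C * (Csp * (m h) ^ (-k) * Real.sqrt (M * β h))) := by gcongr
      _ = C * Csp * Real.sqrt M * ((m h) ^ (1 - k) * (β h) ^ (1 / 2 : ℝ)) := h4
      _ ≤ C * Csp * Real.sqrt M * (C0 * (β h * m h) ^ θ' * ((h : ℕ) : ℝ) ^ (-δ)) := by gcongr
      _ = D * (β h * m h) ^ θ' * ((h : ℕ) : ℝ) ^ (-(δ / 2)) * ((h : ℕ) : ℝ) ^ (-(δ / 2)) := by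
          have : ((h : ℕ) : ℝ) ^ (-δ) =
              ((h : ℕ) : ℝ) ^ (-(δ / 2)) * ((h : ℕ) : ℝ) ^ (-(δ / 2)) := by
            rw [← Real.rpow_add hh0]; congr 1; ring
          rw [this, hD]; ring
  set Z : ℝ := ∑' h : S, ((h : ℕ) : ℝ) ^ (-(δ / 2)) with hZ
  have hZ0 : 0 ≤ Z := tsum_nonneg fun h => by positivity
  refine ⟨D * (Z + 1), by positivity, fun T hT => ?_⟩
  rw [hcard x T]
  push_cast
  rw [← Finset.sum_sub_distrib]
  set V : ℝ := ∑ h ∈ Finset.Icc 1 T, β h * m h with hV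
  have hvnn : ∀ h, 0 ≤ β h * m h := fun h =>
    mul_nonneg ENNReal.toReal_nonneg ENNReal.toReal_nonneg
  have hV0 : 0 ≤ V := Finset.sum_nonneg fun h _ => hvnn h
  have hθpos : 0 ≤ θ' := by linarith
  have hsumS : ∑ h ∈ Finset.Icc 1 T, S.indicator (fun h : ℕ => (h : ℝ) ^ (-(δ / 2))) h ≤ Z := by
    rw [hZ, tsum_subtype S (fun h : ℕ => (h : ℝ) ^ (-(δ / 2)))]
    refine Summable.sum_le_tsum _ (fun h _ => Set.indicator_nonneg (fun h _ => by positivity) h) ?_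
    exact summable_subtype_iff_indicator.1 hsum
  calc |∑ h ∈ Finset.Icc 1 T, ((N x h : ℝ) - β h * m h)|
      ≤ ∑ h ∈ Finset.Icc 1 T, |(N x h : ℝ) - β h * m h| := Finset.abs_sum_le_sum_abs _ _
    _ ≤ ∑ h ∈ Finset.Icc 1 T, D * V ^ θ' * S.indicator (fun h : ℕ => (h : ℝ) ^ (-(δ / 2))) h := by
        refine Finset.sum_le_sum fun h hh => ?_
        by_cases hhS : h ∈ S
        · rw [Set.indicator_of_mem hhS]
          refine (hterm ⟨h, hhS⟩).trans ?_
          have : β h * m h ≤ V :=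
            Finset.single_le_sum (f := fun h => β h * m h) (fun i _ => hvnn i) hh
          have h5 := Real.rpow_le_rpow (hvnn h) this hθpos
          gcongr
        · rw [Set.indicator_of_notMem hhS, hNS x h hhS, hmS h hhS]; simp
    _ = D * V ^ θ' * ∑ h ∈ Finset.Icc 1 T,
          S.indicator (fun h : ℕ => (h : ℝ) ^ (-(δ / 2))) h := by rw [Finset.mul_sum]
    _ ≤ D * V ^ θ' * (Z + 1) := by gcongr; linarith
    _ = D * (Z + 1) * V ^ θ' := by ring
end

section
/- Let G be a locally compact second-countable topological group whose topology is induced by a right-invariant metric ρ with compact closed balls, with a right Haar measure m, and suppose there are d > 0, 0 < c1 ≤ c2 and ε0 > 0 such that c1·ε^d ≤ m(B(e,ε)) ≤ c2·ε^d for all ε ∈ (0, ε0]. For E ⊆ G and ε > 0 put E_ε^+ := E·B(e,ε) and E_ε^- := {x ∈ G : x·B(e,ε) ⊆ E}, and assume these sets are measurable for ε ∈ (0, ε0). Let R ⊆ G be a countable locally finite subset, let v > 0, w ∈ (0,1], k > 0, let Q ⊆ G be measurable with Q' := B(e,ε0)·Q, and let E ⊆ G be measurable with m(E) < ∞ and right-stable: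 there is c3 > 0 with m(E_ε^+ \ E_ε^-) ≤ c3·ε for all ε ∈ (0, ε0). Assume further: the counts #(R ∩ F·y) are finite for all y ∈ Q' and F ∈ {E_ε^+, E_ε^- : ε ∈ (0,ε0)}, and there is C0 > 0 such that for every ε ∈ (0, ε0), every F ∈ {E_ε^+, E_ε^-}, and every δ > 0, m({y ∈ Q' : |#(R ∩ F·y)/v − w·m(F)| > δ}) ≤ C0·δ^{−2}·w·v^{−2k}. Then there exists a constant C' (depending only on d, c1, c2, c3, C0, ε0) such that for every x ∈ Q, provided w·v^{2k} ≥ ε0^{−(d+2)}, one has |#(R ∩ E·x)/v − w·m(E)| ≤ C'·w^{(d+1)/(d+2)}·v^{−2k/(d+2)}. -/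
open MeasureTheory Metric
open scoped Pointwise

/-- The sandwiching argument underlying the uniform pointwise discrepancy bound for
right-stable sets (Theorems 1.4 and 4.4 of the paper). Here `E_ε^+ = E·B(e,ε)`,
`E_ε^- = {x : x·B(e,ε) ⊆ E}`, and `B(x,r)` denotes the closed ball of the
right-invariant metric. -/
theorem uniform_discrepancy_right_stable
    {G : Type*} [Group G] [MetricSpace G] [IsTopologicalGroup G]
    [SecondCountableTopology G] [ProperSpace G] [LocallyCompactSpace G]
    [MeasurableSpace G] [BorelSpace G]
    (m : Measure G) [m.IsMulRightInvariant] [m.IsOpenPosMeasure]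
    [IsFiniteMeasureOnCompacts m]
    (hrt : ∀ x y g : G, dist (x * g) (y * g) = dist x y)
    (d c1 c2 ε0 : ℝ) (hd : 0 < d) (hc1 : 0 < c1) (hc12 : c1 ≤ c2) (hε0 : 0 < ε0)
    (hball : ∀ ε : ℝ, 0 < ε → ε ≤ ε0 →
      ENNReal.ofReal (c1 * ε ^ d) ≤ m (closedBall (1 : G) ε) ∧
        m (closedBall (1 : G) ε) ≤ ENNReal.ofReal (c2 * ε ^ d))
    (c3 C0 : ℝ) (hc3 : 0 < c3) (hC0 : 0 < C0) :
    ∃ C' : ℝ, 0 < C' ∧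
      ∀ R : Set G, R.Countable → (∀ Kc : Set G, IsCompact Kc → (R ∩ Kc).Finite) →
      ∀ v w k : ℝ, 0 < v → 0 < w → w ≤ 1 → 0 < k →
      ∀ Q : Set G, MeasurableSet Q →
      ∀ E : Set G, MeasurableSet E → m E ≠ ⊤ →
      -- measurability of `E_ε^±`
      (∀ ε : ℝ, 0 < ε → ε < ε0 →
        MeasurableSet (E * closedBall (1 : G) ε) ∧
        MeasurableSet {x : G | ∀ b ∈ closedBall (1 : G) ε, x * b ∈ E}) →
      -- right-stability of `E`
      (∀ ε : ℝ, 0 < ε → ε < ε0 →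
        m ((E * closedBall (1 : G) ε) \ {x : G | ∀ b ∈ closedBall (1 : G) ε, x * b ∈ E})
          ≤ ENNReal.ofReal (c3 * ε)) →
      -- finiteness of the counts
      (∀ y ∈ closedBall (1 : G) ε0 * Q, ∀ ε : ℝ, 0 < ε → ε < ε0 →
        ∀ F : Set G, (F = E * closedBall (1 : G) ε ∨
            F = {x : G | ∀ b ∈ closedBall (1 : G) ε, x * b ∈ E}) →
          (R ∩ (fun e => e * y) '' F).Finite) →
      -- Chebyshev-type mean-square hypothesis
      (∀ ε : ℝ, 0 < ε → ε < ε0 →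
        ∀ F : Set G, (F = E * closedBall (1 : G) ε ∨
            F = {x : G | ∀ b ∈ closedBall (1 : G) ε, x * b ∈ E}) →
          ∀ δ : ℝ, 0 < δ →
            m {y ∈ closedBall (1 : G) ε0 * Q |
                δ < |((R ∩ (fun e => e * y) '' F).ncard : ℝ) / v - w * (m F).toReal|}
              ≤ ENNReal.ofReal (C0 * δ ^ (-2 : ℝ) * w * v ^ (-(2 * k)))) →
      ∀ x ∈ Q, ε0 ^ (-(d + 2)) ≤ w * v ^ (2 * k) →
        |((R ∩ (fun e => e * x) '' E).ncard : ℝ) / v - w * (m E).toReal| ≤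
          C' * w ^ ((d + 1) / (d + 2)) * v ^ (-(2 * k) / (d + 2)) := by
  classical
  set A : ℝ := Real.sqrt (C0 * 2 ^ d / c1 + 1) with hA
  have h2d : (0:ℝ) < 2 ^ d := by positivity
  have hApos : 0 < A := Real.sqrt_pos.mpr (by positivity)
  have hAsq : A ^ 2 = C0 * 2 ^ d / c1 + 1 := Real.sq_sqrt (by positivity)
  refine ⟨A + c3, by positivity, ?_⟩
  intro R _ _ v w k hv hw hw1 hk Q _ E _ hEfin _ hstab hcount hcheb x hx hT
  have hd2 : 0 < d + 2 := by linarith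
  set T : ℝ := w * v ^ (2 * k) with hTdef
  have hTpos : 0 < T := by positivity
  set s : ℝ := T ^ (-(1 / (d + 2))) with hs
  have hspos : 0 < s := by positivity
  have hsT : s ^ (d + 2) = T⁻¹ := by
    rw [hs, ← Real.rpow_mul hTpos.le, ← Real.rpow_neg_one]
    congr 1
    field_simp
  have hvk : v ^ (-(2 * k)) = w * s ^ (d + 2) := by
    rw [hsT, hTdef, Real.rpow_neg hv.le]
    have : 0 < v ^ (2 * k) := by positivity
    field_simp
  have hs0 : s ≤ ε0 := by
    have h1 : s ^ (d + 2) ≤ ε0 ^ (d + 2) := by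
      rw [hsT]
      rw [Real.rpow_neg hε0.le] at hT
      exact inv_le_of_inv_le₀ (by positivity) hT
    exact (Real.rpow_le_rpow_iff hspos.le hε0.le hd2).mp h1
  have htarget : w ^ ((d + 1) / (d + 2)) * v ^ (-(2 * k) / (d + 2)) = w * s := by
    rw [hs, hTdef, Real.mul_rpow hw.le (by positivity), ← Real.rpow_mul hv.le, ← mul_assoc]
    congr 1
    · conv_rhs => rw [← Real.rpow_one_add' hw.le (by
        have : 1 / (d + 2) < 1 := by rw [div_lt_one hd2]; linarith
        linarith)]
      congr 1
      field_simp
      ring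
    · congr 1
      ring
  set ε : ℝ := s / 2 with hε
  have hεpos : 0 < ε := by positivity
  have hεlt : ε < ε0 := by linarith
  set δ : ℝ := A * w * s with hδ
  have hδpos : 0 < δ := by positivity
  have hlt : C0 * δ ^ (-2 : ℝ) * w * v ^ (-(2 * k)) < c1 * ε ^ d := by
    have e1 : δ ^ (-2 : ℝ) = (A ^ 2 * w ^ 2 * s ^ 2)⁻¹ := by
      rw [Real.rpow_neg hδpos.le, hδ]
      norm_num
      ring
    have e2 : s ^ (d + 2) = s ^ d * s ^ 2 := by
      rw [Real.rpow_add hspos]; norm_num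
    have e3 : ε ^ d = s ^ d / 2 ^ d := Real.div_rpow hspos.le (by norm_num) d
    have hsd : 0 < s ^ d := by positivity
    rw [hvk, e1, e2, e3]
    have e4 : C0 * (A ^ 2 * w ^ 2 * s ^ 2)⁻¹ * w * (w * (s ^ d * s ^ 2)) = C0 / A ^ 2 * s ^ d := by
      field_simp
    rw [e4, mul_div_assoc', mul_div_right_comm]
    apply mul_lt_mul_of_pos_right _ hsd
    rw [div_lt_div_iff₀ (by positivity) h2d, hAsq, mul_add, mul_div_cancel₀ _ hc1.ne']
    linarith
  set Ep : Set G := E * closedBall (1 : G) ε with hEp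
  set Em : Set G := {x : G | ∀ b ∈ closedBall (1 : G) ε, x * b ∈ E} with hEm
  have hone : (1 : G) ∈ closedBall (1 : G) ε := mem_closedBall_self hεpos.le
  have hEEp : E ⊆ Ep := fun e he => ⟨e, he, 1, hone, mul_one e⟩
  have hEmE : Em ⊆ E := fun e he => by simpa using he 1 hone
  have hst := hstab ε hεpos hεlt
  -- a good translate exists
  have key : ∀ F : Set G, (F = Ep ∨ F = Em) → ∃ b ∈ closedBall (1 : G) ε,
      b * x ∈ closedBall (1 : G) ε0 * Q ∧
      |((R ∩ (fun e => e * (b * x)) '' F).ncard : ℝ) / v - w * (m F).toReal| ≤ δ := by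
    intro F hF
    by_contra hcon
    push Not at hcon
    have hch := hcheb ε hεpos hεlt F hF δ hδpos
    have hsub : (fun y => y * x⁻¹) ⁻¹' closedBall (1 : G) ε ⊆
        {y ∈ closedBall (1 : G) ε0 * Q |
          δ < |((R ∩ (fun e => e * y) '' F).ncard : ℝ) / v - w * (m F).toReal|} := by
      intro y hy
      have hy' : y * x⁻¹ ∈ closedBall (1 : G) ε := hy
      have hmem : y * x⁻¹ * x ∈ closedBall (1 : G) ε0 * Q :=
        Set.mul_mem_mul (closedBall_subset_closedBall hεlt.le hy') hx
      have := hcon _ hy' hmem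
      rw [inv_mul_cancel_right] at this hmem
      exact ⟨hmem, this⟩
    have h1 := (measure_mono hsub).trans hch
    rw [measure_preimage_mul_right] at h1
    have h2 := ((hball ε hεpos hεlt.le).1.trans h1)
    have h3 : ENNReal.ofReal (C0 * δ ^ (-2 : ℝ) * w * v ^ (-(2 * k))) <
        ENNReal.ofReal (c1 * ε ^ d) := (ENNReal.ofReal_lt_ofReal_iff (by positivity)).mpr hlt
    exact absurd h2 (not_le.mpr h3)
  have hEpm : m Ep ≤ m E + ENNReal.ofReal (c3 * ε) := by
    have : Ep ⊆ E ∪ (Ep \ Em) := by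
      intro y hy
      by_cases h : y ∈ Em
      · exact Or.inl (hEmE h)
      · exact Or.inr ⟨hy, h⟩
    exact (measure_mono this).trans ((measure_union_le _ _).trans (by gcongr))
  have hEmm : m E ≤ m Em + ENNReal.ofReal (c3 * ε) := by
    have : E ⊆ Em ∪ (Ep \ Em) := by
      intro y hy
      by_cases h : y ∈ Em
      · exact Or.inl h
      · exact Or.inr ⟨hEEp hy, h⟩
    exact (measure_mono this).trans ((measure_union_le _ _).trans (by gcongr))
  have hEmfin : m Em ≠ ⊤ := ne_top_of_le_ne_top hEfin (measure_mono hEmE)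
  have hrp : (m Ep).toReal ≤ (m E).toReal + c3 * ε := by
    have := ENNReal.toReal_mono (ENNReal.add_ne_top.mpr ⟨hEfin, ENNReal.ofReal_ne_top⟩) hEpm
    rwa [ENNReal.toReal_add hEfin ENNReal.ofReal_ne_top,
      ENNReal.toReal_ofReal (by positivity)] at this
  have hrm : (m E).toReal ≤ (m Em).toReal + c3 * ε := by
    have := ENNReal.toReal_mono (ENNReal.add_ne_top.mpr ⟨hEmfin, ENNReal.ofReal_ne_top⟩) hEmm
    rwa [ENNReal.toReal_add hEmfin ENNReal.ofReal_ne_top,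
      ENNReal.toReal_ofReal (by positivity)] at this
  obtain ⟨b, hb, hbQ, hbp⟩ := key Ep (Or.inl rfl)
  obtain ⟨b', hb', _, hbm⟩ := key Em (Or.inr rfl)
  have hbinv : b⁻¹ ∈ closedBall (1 : G) ε := by
    rw [mem_closedBall, ← hrt _ _ b, inv_mul_cancel, one_mul, dist_comm]
    exact hb
  have hsubp : (fun e => e * x) '' E ⊆ (fun e => e * (b * x)) '' Ep := by
    rintro _ ⟨e, he, rfl⟩
    exact ⟨e * b⁻¹, ⟨e, he, b⁻¹, hbinv, rfl⟩, by simp [mul_assoc]⟩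
  have hsubm : (fun e => e * (b' * x)) '' Em ⊆ (fun e => e * x) '' E := by
    rintro _ ⟨e, he, rfl⟩
    exact ⟨e * b', he b' hb', by simp [mul_assoc]⟩
  have hfin := hcount _ hbQ ε hεpos hεlt Ep (Or.inl rfl)
  have hfinE := hfin.subset (Set.inter_subset_inter_right R hsubp)
  have hn1 : ((R ∩ (fun e => e * x) '' E).ncard : ℝ) / v ≤
      ((R ∩ (fun e => e * (b * x)) '' Ep).ncard : ℝ) / v := by
    gcongr
  have hn2 : ((R ∩ (fun e => e * (b' * x)) '' Em).ncard : ℝ) / v ≤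
      ((R ∩ (fun e => e * x) '' E).ncard : ℝ) / v := by
    gcongr
  rw [mul_assoc, htarget]
  have hwp := mul_le_mul_of_nonneg_left hrp hw.le
  have hwm := mul_le_mul_of_nonneg_left hrm hw.le
  rw [abs_le] at hbp hbm ⊢
  have hfinal : δ + w * (c3 * ε) ≤ (A + c3) * (w * s) := by
    have : 0 < c3 * w * s := by positivity
    rw [hδ, hε]
    linarith
  rw [mul_add] at hwp hwm
  constructor <;> linarith [hbp.1, hbp.2, hbm.1, hbm.2]
end

section
/- Let G be a locally compact second-countable topological group whose topology is induced by a right-invariant metric ρ with compact closed balls, with a right Haar measure m, and suppose there are d > 0, 0 < c1 ≤ c2, c3 > 0 and r0 > 0 such that c1·r^d ≤ m(B(e,r)) ≤ c2·r^d for all r ∈ (0, r0), and m(B(e,r+ε)) − m(B(e,r)) ≤ c3·(ε/r)·m(B(e,r)) for all 0 < ε < r < r0. Let R ⊆ G be a countable locally finite subset, let v > 0, w ∈ (0,1], k > 0, let Q ⊆ G be measurable with Q' := B(e,r0)·Q, and assume there is C0 > 0 such that for every r ∈ (0, r0) and δ > 0, m({y ∈ Q' : |#(R ∩ B(e,r)·y)/v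 − w·m(B(e,r))| > δ}) ≤ C0·δ^{−2}·m(B(e,r))·w·v^{−2k}. Then there exist ℓ0 ∈ (0, r0) and a constant C' (depending only on d, c1, c2, c3, C0, r0) such that for every x ∈ Q and every ℓ ∈ (0, ℓ0) with m(B(e,ℓ))²·w ≥ v^{−2k}, one has |#(R ∩ B(x,ℓ)) − w·m(B(e,ℓ))·v| ≤ C'·m(B(e,ℓ))^{d/(d+2)}·w^{(d+1)/(d+2)}·v^{1−2k/(d+2)}. -/
open MeasureTheory Metric
open scoped Pointwise

lemma usb_image {G : Type*} [Group G] [MetricSpace G]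
    (hrt : ∀ x y g : G, dist (x * g) (y * g) = dist x y) (y : G) (r : ℝ) :
    (fun b => b * y) '' closedBall (1 : G) r = closedBall y r := by
  ext z
  simp only [Set.mem_image, mem_closedBall]
  constructor
  · rintro ⟨b, hb, rfl⟩
    have := hrt b 1 y
    rw [one_mul] at this
    rwa [this]
  · intro hz
    refine ⟨z * y⁻¹, ?_, by simp⟩
    have := hrt z y y⁻¹
    rw [mul_inv_cancel] at this
    rwa [this]

lemma usb_measure {G : Type*} [Group G] [MetricSpace G] [IsTopologicalGroup G]
    [MeasurableSpace G] [BorelSpace G] (m : Measure G) [m.IsMulRightInvariant]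
    (hrt : ∀ x y g : G, dist (x * g) (y * g) = dist x y) (x : G) (r : ℝ) :
    m (closedBall x r) = m (closedBall 1 r) := by
  rw [← measure_preimage_mul_right m x (closedBall x r)]
  congr 1
  ext z
  simp only [Set.mem_preimage, mem_closedBall]
  have := hrt z 1 x
  rw [one_mul] at this
  rw [this]

lemma usb_final (d M w v k : ℝ) (hd : 0 < d) (hM : 0 < M) (hw : 0 < w) (hv : 0 < v) :
    v * w * M * (v ^ (-(2 * k)) / (M ^ 2 * w)) ^ (1 / (d + 2)) =
      M ^ (d / (d + 2)) * w ^ ((d + 1) / (d + 2)) * v ^ (1 - 2 * k / (d + 2)) := by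
  have hd2 : d + 2 ≠ 0 := by positivity
  have e1 : d / (d + 2) = 1 - 2 * (1 / (d + 2)) := by field_simp; ring
  have e2 : (d + 1) / (d + 2) = 1 - 1 / (d + 2) := by field_simp; ring
  have e3 : 1 - 2 * k / (d + 2) = 1 + (-(2 * k)) * (1 / (d + 2)) := by field_simp; ring
  rw [e1, e2, e3, Real.rpow_sub hM, Real.rpow_sub hw, Real.rpow_add hv,
    Real.div_rpow (by positivity) (by positivity), Real.mul_rpow (by positivity) hw.le,
    ← Real.rpow_two, ← Real.rpow_mul hM.le, ← Real.rpow_mul hv.le, Real.rpow_one, Real.rpow_one,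
    Real.rpow_one]
  have := Real.rpow_pos_of_pos hM (2 * (1 / (d + 2)))
  have := Real.rpow_pos_of_pos hw (1 / (d + 2))
  field_simp

/-- The numerical inequality showing the exceptional set is smaller than a ball. -/
lemma usb_num (d c1 c2 C0 M Mr K D w V T t ℓ : ℝ) (hd : 0 < d) (hc1 : 0 < c1) (hc2 : 0 < c2)
    (hC0 : 0 < C0)
    (hM : 0 < M) (hK : 0 < K) (hD : 0 < D) (hw : 0 < w) (hV : 0 < V) (hℓ : 0 < ℓ)
    (hT : T = V / (M ^ 2 * w)) (ht : t = T ^ (1 / (d + 2)) / 4)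
    (hMr : Mr ≤ K * M) (hMl : M ≤ c2 * ℓ ^ d)
    (hD2 : D ^ 2 = 2 * C0 * K * 4 ^ (d + 2) * c2 / c1) :
    C0 * (D * w * t * M) ^ (-2 : ℝ) * Mr * w * V < c1 * (t * ℓ) ^ d := by
  have hTpos : 0 < T := by rw [hT]; positivity
  have htpos : 0 < t := by rw [ht]; positivity
  have h4 : (0 : ℝ) < 4 ^ (d + 2) := by positivity
  have hTt : T = 4 ^ (d + 2) * (t ^ d * t ^ 2) := by
    have h1 : (4 * t) ^ (d + 2) = T := by
      rw [ht, mul_div_cancel₀ _ (by norm_num : (4 : ℝ) ≠ 0), ← Real.rpow_mul hTpos.le,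
        one_div_mul_cancel (by positivity), Real.rpow_one]
    rw [← h1, Real.mul_rpow (by norm_num) htpos.le, Real.rpow_add htpos, Real.rpow_two]
  have hVT : V = T * (M ^ 2 * w) := by rw [hT]; field_simp
  have hl : 0 < ℓ ^ d := Real.rpow_pos_of_pos hℓ d
  have htd : 0 < t ^ d := Real.rpow_pos_of_pos htpos d
  have hpow : (D * w * t * M) ^ (-2 : ℝ) = 1 / (D * w * t * M) ^ 2 := by
    rw [Real.rpow_neg (by positivity), Real.rpow_two, one_div]
  rw [hpow, Real.mul_rpow htpos.le hℓ.le]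
  calc C0 * (1 / (D * w * t * M) ^ 2) * Mr * w * V
      ≤ C0 * (1 / (D * w * t * M) ^ 2) * (K * (M)) * w * V := by gcongr
    _ = C0 * K * 4 ^ (d + 2) * t ^ d / D ^ 2 * M := by
        rw [hVT, hTt]; field_simp
    _ ≤ C0 * K * 4 ^ (d + 2) * t ^ d / D ^ 2 * (c2 * ℓ ^ d) := by gcongr
    _ = c1 / 2 * (t ^ d * ℓ ^ d) := by rw [hD2]; field_simp
    _ < c1 * (t ^ d * ℓ ^ d) := by
        have : 0 < c1 * (t ^ d * ℓ ^ d) := by positivity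
        linarith

/-- The uniform discrepancy bound at arbitrarily small scales (Theorems 1.5 and 4.5 of
the paper): a pointwise bound, at every point `x` and every sufficiently small radius
`ℓ`, for the discrepancy of a locally finite set `R` in the balls `B(x,ℓ)` of a
right-invariant metric, assuming a Chebyshev-type mean-square hypothesis for balls. -/
theorem uniform_discrepancy_small_balls
    {G : Type*} [Group G] [MetricSpace G] [IsTopologicalGroup G]
    [SecondCountableTopology G] [ProperSpace G] [LocallyCompactSpace G]
    [MeasurableSpace G] [BorelSpace G]
    (m : Measure G) [m.IsMulRightInvariant] [m.IsOpenPosMeasure]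
    [IsFiniteMeasureOnCompacts m]
    (hrt : ∀ x y g : G, dist (x * g) (y * g) = dist x y)
    (d c1 c2 c3 r0 : ℝ) (hd : 0 < d) (hc1 : 0 < c1) (hc12 : c1 ≤ c2) (hc3 : 0 < c3)
    (hr0 : 0 < r0)
    (hball : ∀ r : ℝ, 0 < r → r < r0 →
      ENNReal.ofReal (c1 * r ^ d) ≤ m (closedBall (1 : G) r) ∧
        m (closedBall (1 : G) r) ≤ ENNReal.ofReal (c2 * r ^ d))
    (hannulus : ∀ r ε : ℝ, 0 < ε → ε < r → r < r0 →
      (m (closedBall (1 : G) (r + ε))).toReal - (m (closedBall (1 : G) r)).toReal ≤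
        c3 * (ε / r) * (m (closedBall (1 : G) r)).toReal)
    (C0 : ℝ) (hC0 : 0 < C0) :
    ∃ ℓ0 : ℝ, 0 < ℓ0 ∧ ℓ0 < r0 ∧ ∃ C' : ℝ, 0 < C' ∧
      ∀ R : Set G, R.Countable → (∀ Kc : Set G, IsCompact Kc → (R ∩ Kc).Finite) →
      ∀ v w k : ℝ, 0 < v → 0 < w → w ≤ 1 → 0 < k →
      ∀ Q : Set G, MeasurableSet Q →
      -- Chebyshev-type mean-square hypothesis for balls
      (∀ r : ℝ, 0 < r → r < r0 → ∀ δ : ℝ, 0 < δ →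
        m {y ∈ closedBall (1 : G) r0 * Q |
            δ < |((R ∩ (fun b => b * y) '' closedBall (1 : G) r).ncard : ℝ) / v -
              w * (m (closedBall (1 : G) r)).toReal|}
          ≤ ENNReal.ofReal (C0 * δ ^ (-2 : ℝ) * (m (closedBall (1 : G) r)).toReal *
              w * v ^ (-(2 * k)))) →
      ∀ x ∈ Q, ∀ ℓ : ℝ, 0 < ℓ → ℓ < ℓ0 →
        v ^ (-(2 * k)) ≤ (m (closedBall (1 : G) ℓ)).toReal ^ 2 * w →
        |((R ∩ closedBall x ℓ).ncard : ℝ) -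
            w * (m (closedBall (1 : G) ℓ)).toReal * v| ≤
          C' * (m (closedBall (1 : G) ℓ)).toReal ^ (d / (d + 2)) *
            w ^ ((d + 1) / (d + 2)) * v ^ (1 - 2 * k / (d + 2)) := by
  have hc2 : 0 < c2 := lt_of_lt_of_le hc1 hc12
  obtain ⟨K, hKdef⟩ : ∃ K : ℝ, K = 2 ^ d * c2 / c1 := ⟨_, rfl⟩
  have hK : 0 < K := by rw [hKdef]; positivity
  obtain ⟨D, hDdef⟩ : ∃ D : ℝ, D = Real.sqrt (2 * C0 * K * 4 ^ (d + 2) * c2 / c1) := ⟨_, rfl⟩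
  have hD : 0 < D := by rw [hDdef]; positivity
  have hD2 : D ^ 2 = 2 * C0 * K * 4 ^ (d + 2) * c2 / c1 := by
    rw [hDdef]; exact Real.sq_sqrt (by positivity)
  refine ⟨r0 / 2, by linarith, by linarith, (2 * c3 + D) / 4, by positivity, ?_⟩
  intro R _ hR v w k hv hw _ _ Q _ hCh x hx ℓ hℓ hℓ0 hcond
  have hfin : ∀ r : ℝ, m (closedBall (1 : G) r) ≠ ⊤ := fun r =>
    (isCompact_closedBall _ _).measure_lt_top.ne
  obtain ⟨f, hf⟩ : ∃ f : ℝ → ℝ, ∀ r, f r = (m (closedBall (1 : G) r)).toReal := ⟨_, fun _ => rfl⟩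
  simp only [← hf] at hannulus hCh hcond ⊢
  have hlow : ∀ r : ℝ, 0 < r → r < r0 → c1 * r ^ d ≤ f r := by
    intro r h1 h2
    rw [hf]
    exact (ENNReal.ofReal_le_iff_le_toReal (hfin r)).1 (hball r h1 h2).1
  have hupp : ∀ r : ℝ, 0 < r → r < r0 → f r ≤ c2 * r ^ d := by
    intro r h1 h2
    rw [hf]
    exact ENNReal.toReal_le_of_le_ofReal (by positivity) (hball r h1 h2).2
  have hmono : ∀ r s : ℝ, r ≤ s → f r ≤ f s := by
    intro r s h
    rw [hf, hf]
    exact ENNReal.toReal_mono (hfin s) (measure_mono (closedBall_subset_closedBall h))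
  have hM : 0 < f ℓ := lt_of_lt_of_le (by positivity) (hlow ℓ hℓ (by linarith))
  have hV : 0 < v ^ (-(2 * k)) := by positivity
  obtain ⟨T, hT⟩ : ∃ T : ℝ, T = v ^ (-(2 * k)) / (f ℓ ^ 2 * w) := ⟨_, rfl⟩
  have hTpos : 0 < T := by rw [hT]; positivity
  have hT1 : T ≤ 1 := by rw [hT]; exact (div_le_one (by positivity)).2 hcond
  obtain ⟨t, ht⟩ : ∃ t : ℝ, t = T ^ (1 / (d + 2)) / 4 := ⟨_, rfl⟩
  have htpos : 0 < t := by rw [ht]; positivity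
  have ht1 : t ≤ 1 / 4 := by
    have := Real.rpow_le_one hTpos.le hT1 (by positivity : 0 ≤ 1 / (d + 2))
    rw [ht]; linarith
  have hε : 0 < t * ℓ := by positivity
  have hε4 : t * ℓ ≤ ℓ / 4 := by nlinarith
  have hMK : ∀ r : ℝ, r ≤ 2 * ℓ → f r ≤ K * f ℓ := by
    intro r hr
    calc f r ≤ f (2 * ℓ) := hmono _ _ hr
      _ ≤ c2 * (2 * ℓ) ^ d := hupp _ (by linarith) (by linarith)
      _ = K * (c1 * ℓ ^ d) := by
        rw [hKdef, Real.mul_rpow (by norm_num) hℓ.le]; field_simp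
      _ ≤ K * f ℓ := by gcongr; exact hlow ℓ hℓ (by linarith)
  -- existence of a good centre
  have hgood : ∀ r : ℝ, 0 < r → r ≤ 2 * ℓ → ∃ y ∈ closedBall x (t * ℓ),
      |((R ∩ closedBall y r).ncard : ℝ) / v - w * f r| ≤ D * w * t * f ℓ := by
    intro r hr hr2
    by_contra! hcon
    have h1 := hCh r hr (by linarith) (D * w * t * f ℓ) (by positivity)
    have hsub : closedBall x (t * ℓ) ⊆ {y ∈ closedBall (1 : G) r0 * Q |
        D * w * t * f ℓ < |((R ∩ (fun b => b * y) '' closedBall (1 : G) r).ncard : ℝ) / v -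
          w * f r|} := by
      intro y hy
      refine ⟨?_, ?_⟩
      · refine Set.mem_mul.2 ⟨y * x⁻¹, ?_, x, hx, by simp⟩
        rw [mem_closedBall] at hy ⊢
        have := hrt y x x⁻¹
        rw [mul_inv_cancel] at this
        rw [this]; linarith
      · rw [usb_image hrt]
        exact hcon y hy
    have h2 := (measure_mono hsub).trans h1
    rw [usb_measure m hrt] at h2
    have h3 := (hball (t * ℓ) hε (by linarith)).1.trans h2
    have hnum := usb_num d c1 c2 C0 (f ℓ) (f r) K D w (v ^ (-(2 * k))) T t ℓ hd hc1 hc2 hC0 hM hK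
      hD hw hV hℓ hT ht (hMK r hr2) (hupp ℓ hℓ (by linarith)) hD2
    have hpos : 0 < c1 * (t * ℓ) ^ d := by positivity
    exact absurd h3 (not_le.2 ((ENNReal.ofReal_lt_ofReal_iff hpos).2 hnum))
  have hfinR : ∀ (y : G) (r : ℝ), (R ∩ closedBall y r).Finite := fun y r =>
    hR _ (isCompact_closedBall _ _)
  have hrhs : (2 * c3 + D) / 4 * f ℓ ^ (d / (d + 2)) * w ^ ((d + 1) / (d + 2)) *
      v ^ (1 - 2 * k / (d + 2)) = v * (w * (2 * c3 * t * f ℓ)) + v * (D * w * t * f ℓ) := by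
    have h := usb_final d (f ℓ) w v k hd hM hw hv
    rw [← hT] at h
    have : T ^ (1 / (d + 2)) = 4 * t := by rw [ht]; ring
    rw [this] at h
    linear_combination (-(2 * c3 + D) / 4) * h
  rw [hrhs, abs_le]
  constructor
  · obtain ⟨y, hy, hyg⟩ := hgood (ℓ - t * ℓ) (by linarith) (by linarith)
    have hyd := mem_closedBall.1 hy
    have hsub : R ∩ closedBall y (ℓ - t * ℓ) ⊆ R ∩ closedBall x ℓ :=
      Set.inter_subset_inter_right _ (closedBall_subset_closedBall' (by linarith))
    have hc : ((R ∩ closedBall y (ℓ - t * ℓ)).ncard : ℝ) ≤ (R ∩ closedBall x ℓ).ncard := by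
      exact_mod_cast Set.ncard_le_ncard hsub (hfinR _ _)
    have han := hannulus (ℓ - t * ℓ) (t * ℓ) hε (by linarith) (by linarith)
    rw [sub_add_cancel] at han
    have hq : t * ℓ / (ℓ - t * ℓ) ≤ 2 * t := by
      rw [div_le_iff₀ (by linarith)]; nlinarith
    have hm := hmono (ℓ - t * ℓ) ℓ (by linarith)
    have hm0 : 0 ≤ f (ℓ - t * ℓ) := by rw [hf]; positivity
    have han2 : f ℓ - f (ℓ - t * ℓ) ≤ 2 * c3 * t * f ℓ := by
      calc _ ≤ _ := han
        _ ≤ c3 * (2 * t) * f ℓ := by gcongr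
        _ = _ := by ring
    have h1 := (abs_le.1 hyg).1
    have h2 : v * (w * f (ℓ - t * ℓ) - D * w * t * f ℓ) ≤
        ((R ∩ closedBall y (ℓ - t * ℓ)).ncard : ℝ) := by
      rw [mul_comm, ← le_div_iff₀ hv]; linarith
    have h3 := mul_le_mul_of_nonneg_left han2 (mul_pos hv hw).le
    linarith
  · obtain ⟨y, hy, hyg⟩ := hgood (ℓ + t * ℓ) (by linarith) (by linarith)
    have hyd := mem_closedBall'.1 hy
    have hsub : R ∩ closedBall x ℓ ⊆ R ∩ closedBall y (ℓ + t * ℓ) :=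
      Set.inter_subset_inter_right _ (closedBall_subset_closedBall' (by linarith))
    have hc : ((R ∩ closedBall x ℓ).ncard : ℝ) ≤ (R ∩ closedBall y (ℓ + t * ℓ)).ncard := by
      exact_mod_cast Set.ncard_le_ncard hsub (hfinR _ _)
    have han := hannulus ℓ (t * ℓ) hε (by linarith) (by linarith)
    rw [mul_div_cancel_right₀ _ hℓ.ne'] at han
    have han2 : f (ℓ + t * ℓ) - f ℓ ≤ 2 * c3 * t * f ℓ := by
      have : 0 < c3 * t * f ℓ := by positivity
      linarith
    have h1 := (abs_le.1 hyg).2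
    have h2 : ((R ∩ closedBall y (ℓ + t * ℓ)).ncard : ℝ) ≤
        v * (w * f (ℓ + t * ℓ) + D * w * t * f ℓ) := by
      rw [mul_comm v, ← div_le_iff₀ hv]; linarith
    have h3 := mul_le_mul_of_nonneg_left han2 (mul_pos hv hw).le
    linarith
end

section
/- Let G be a locally compact second-countable topological group with a right-invariant Haar measure m, let Γ be a countable subgroup of G acting on G by right multiplication, and let F ⊆ G be a measurable fundamental domain for this action. Let B ⊆ G be measurable with m(B) < ∞, and suppose N(B) := #{γ ∈ Γ : m(B ∩ B·γ⁻¹) > 0} is finite. Then ∫_F ( ∑_{γ ∈ Γ} 1_B(g·γ) )² dm(g) ≤ N(B)·m(B). -/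
open MeasureTheory

/-- The bound on the `L²` norm of the `Γ`-periodization of the indicator function of `B`
in terms of the overlap number `N(B)` (the final estimate in the proofs of
Theorems 3.2 and 4.1 of the paper). -/
theorem periodization_sq_lintegral_le
    {G : Type*} [Group G] [TopologicalSpace G] [IsTopologicalGroup G]
    [LocallyCompactSpace G] [SecondCountableTopology G]
    [MeasurableSpace G] [BorelSpace G]
    (m : Measure G) [m.IsMulRightInvariant] [m.IsOpenPosMeasure]
    [IsFiniteMeasureOnCompacts m]
    (Γ : Subgroup G) [Countable Γ]
    (F : Set G) (hF : IsFundamentalDomain Γ.op F m)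
    (B : Set G) (hBm : MeasurableSet B) (hBfin : m B < ⊤)
    (hN : {γ : Γ | 0 < m (B ∩ (fun b => b * (γ : G)⁻¹) '' B)}.Finite) :
    ∫⁻ g in F, (∑' γ : Γ, B.indicator (fun _ => (1 : ENNReal)) (g * (γ : G))) ^ 2 ∂m ≤
      ({γ : Γ | 0 < m (B ∩ (fun b => b * (γ : G)⁻¹) '' B)}.ncard : ENNReal) * m B := by
  classical
  haveI : Countable Γ.op := Γ.equivOp.symm.injective.countable
  set f : G → ENNReal := B.indicator (fun _ => (1 : ENNReal)) with hf
  have hfm : Measurable f := measurable_const.indicator hBm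
  set P : G → ENNReal := fun g => ∑' γ : Γ, f (g * (γ : G)) with hP
  have hPm : Measurable P :=
    Measurable.ennreal_tsum fun γ => hfm.comp (measurable_mul_const (γ : G))
  have hPinv : ∀ (g : G) (γ : Γ), P (g * (γ : G)) = P g := by
    intro g γ
    simp only [hP]
    rw [← (Equiv.mulLeft γ).tsum_eq (fun δ : Γ => f (g * (δ : G)))]
    simp [mul_assoc]
  have hsq : ∀ g, (P g) ^ 2 = ∑' γ : Γ, f (g * (γ : G)) * P (g * (γ : G)) := by
    intro g
    simp only [hPinv]
    rw [ENNReal.tsum_mul_right, sq]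
  have h1 : ∫⁻ g in F, (P g) ^ 2 ∂m = ∫⁻ g, f g * P g ∂m := by
    rw [hF.lintegral_eq_tsum'', ← Γ.equivOp.tsum_eq]
    simp only [hsq]
    rw [lintegral_tsum]
    · rfl
    · intro γ
      exact ((hfm.mul hPm).comp (measurable_mul_const (γ : G))).aemeasurable
  have himg : ∀ γ : Γ, (fun b => b * (γ : G)⁻¹) '' B = (fun b => b * (γ : G)) ⁻¹' B := by
    intro γ
    ext x
    constructor
    · rintro ⟨b, hb, rfl⟩
      simpa using hb
    · intro hx
      exact ⟨x * γ, hx, by simp⟩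
  have h2 : ∫⁻ g, f g * P g ∂m = ∑' γ : Γ, m (B ∩ (fun b => b * (γ : G)⁻¹) '' B) := by
    simp only [hP, ← ENNReal.tsum_mul_left]
    rw [lintegral_tsum]
    · refine tsum_congr fun γ => ?_
      rw [himg, ← lintegral_indicator_one (hBm.inter (measurable_mul_const (γ : G) hBm))]
      refine lintegral_congr fun g => ?_
      by_cases h : g ∈ B <;> by_cases h' : g * (γ : G) ∈ B <;> simp [hf, h, h']
    · intro γ
      exact (hfm.mul (hfm.comp (measurable_mul_const (γ : G)))).aemeasurable
  change ∫⁻ g in F, (P g) ^ 2 ∂m ≤ _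
  rw [h1, h2, tsum_eq_sum (s := hN.toFinset), Set.ncard_eq_toFinset_card _ hN]
  · refine (Finset.sum_le_card_nsmul _ _ (m B) fun γ _ => measure_mono Set.inter_subset_left).trans ?_
    rw [nsmul_eq_mul]
  · intro γ hγ
    simpa using hγ
end

section
/- Let G1 be a locally compact second-countable unimodular topological group with Haar measure m1; let G2 be a locally compact second-countable unimodular topological group with Haar measure m2 admitting a compact open subgroup K with m2(K) = 1; let Γ be a discrete subgroup of G1 × G2, and for γ ∈ Γ write γ = (γ1, γ2). Let E ⊆ G1 be measurable, and let B ⊆ G2 be a measurable, relatively compact set that is K-bi-invariant, i.e. K·B·K = B. Then for every x ∈ G1 and every u ∈ K, the number of γ ∈ Γ with γ1 ∈ E·x and γ2 ∈ B equals ∫_{B} ( ∑_{γ ∈ Γ} 1_{E⁻¹}(x·γ1⁻¹)·1_K(a·u·γ2⁻¹) ) dm2(a), with both sides taking values in [0, ∞]. In particular, the integral is independent of u ∈ K. -/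
open MeasureTheory

/-- The counting identity (formula (4.4), 'eq:form') of the paper: the number of lattice
points `γ ∈ Γ` with `γ₁ ∈ E·x` and `γ₂ ∈ B` equals the orbital integral over `B` of the
`Γ`-periodization of the indicator of `E⁻¹ × K`, for any `u ∈ K`. -/
theorem lattice_count_eq_orbital_integral
    {G1 : Type*} [Group G1] [TopologicalSpace G1] [IsTopologicalGroup G1]
    [LocallyCompactSpace G1] [SecondCountableTopology G1]
    [MeasurableSpace G1] [BorelSpace G1]
    (m1 : Measure G1) [m1.IsHaarMeasure] [m1.IsMulRightInvariant]
    {G2 : Type*} [Group G2] [TopologicalSpace G2] [IsTopologicalGroup G2]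
    [LocallyCompactSpace G2] [SecondCountableTopology G2] [T2Space G2]
    [MeasurableSpace G2] [BorelSpace G2]
    (m2 : Measure G2) [m2.IsHaarMeasure] [m2.IsMulRightInvariant]
    (K : Subgroup G2) (hKc : IsCompact (K : Set G2)) (hKo : IsOpen (K : Set G2))
    (hK1 : m2 (K : Set G2) = 1)
    (Γ : Subgroup (G1 × G2)) [DiscreteTopology Γ]
    (E : Set G1) (hEm : MeasurableSet E)
    (B : Set G2) (hBm : MeasurableSet B) (hBc : IsCompact (closure B))
    (hBbi : ∀ u ∈ K, ∀ v ∈ K, ∀ g : G2, u * g * v ∈ B ↔ g ∈ B)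
    (x : G1) (u : G2) (hu : u ∈ K) :
    ({γ : Γ | (γ : G1 × G2).1 ∈ (fun e => e * x) '' E ∧ (γ : G1 × G2).2 ∈ B}.encard
        : ENNReal) =
      ∫⁻ a in B,
        ∑' γ : Γ,
          E⁻¹.indicator (fun _ => (1 : ENNReal)) (x * (γ : G1 × G2).1⁻¹) *
            (K : Set G2).indicator (fun _ => (1 : ENNReal)) (a * u * (γ : G1 × G2).2⁻¹)
          ∂m2 := by
  have hcount : Countable Γ := countable_of_Lindelof_of_discrete
  have hmeas : ∀ γ : Γ, Measurable (fun a : G2 =>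
      (K : Set G2).indicator (fun _ => (1 : ENNReal)) (a * u * (γ : G1 × G2).2⁻¹)) := by
    intro γ
    have h1 : Measurable ((K : Set G2).indicator (fun _ => (1 : ENNReal))) :=
      measurable_const.indicator hKo.measurableSet
    have h2 : Measurable (fun a : G2 => a * u * (γ : G1 × G2).2⁻¹) :=
      Continuous.measurable (by fun_prop)
    exact h1.comp h2
  rw [lintegral_tsum (fun γ => ((hmeas γ).const_mul _).aemeasurable)]
  rw [← ENNReal.tsum_set_one, tsum_subtype _ (fun _ : Γ => (1 : ENNReal))]
  refine tsum_congr fun γ => ?_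
  rw [lintegral_const_mul _ (hmeas γ)]
  have hint : ∫⁻ a in B, (K : Set G2).indicator (fun _ => (1 : ENNReal))
      (a * u * (γ : G1 × G2).2⁻¹) ∂m2 = B.indicator (fun _ => 1) (γ : G1 × G2).2 := by
    rw [← lintegral_indicator hBm]
    have hpt : ∀ a : G2, B.indicator (fun a => (K : Set G2).indicator (fun _ => (1 : ENNReal))
        (a * u * (γ : G1 × G2).2⁻¹)) a = B.indicator (fun _ => 1) (γ : G1 × G2).2 *
          (K : Set G2).indicator (fun _ => (1 : ENNReal)) (a * (u * (γ : G1 × G2).2⁻¹)) := by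
      intro a
      rw [← mul_assoc]
      by_cases hk : a * u * (γ : G1 × G2).2⁻¹ ∈ (K : Set G2)
      · have h := hBbi _ hk _ (K.inv_mem hu) (γ : G1 × G2).2
        have e : a * u * (γ : G1 × G2).2⁻¹ * (γ : G1 × G2).2 * u⁻¹ = a := by group
        rw [e] at h
        by_cases hb : a ∈ B
        · simp [Set.indicator, hb, h.1 hb]
        · simp [Set.indicator, hb, ← h]
      · by_cases hb : a ∈ B <;> simp only [Set.indicator, hb, hk, if_true, if_false, mul_zero]
    simp_rw [hpt]
    have hm : Measurable ((K : Set G2).indicator (fun _ => (1 : ENNReal))) :=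
      measurable_const.indicator hKo.measurableSet
    rw [lintegral_const_mul _ (by simpa only [mul_assoc] using hmeas γ),
      lintegral_mul_right_eq_self (μ := m2) ((K : Set G2).indicator (fun _ => (1 : ENNReal))),
      lintegral_indicator_const hKo.measurableSet, hK1]
    simp
  rw [hint]
  have hE : x * (γ : G1 × G2).1⁻¹ ∈ E⁻¹ ↔ (γ : G1 × G2).1 ∈ (fun e => e * x) '' E := by
    rw [Set.mem_inv, mul_inv_rev, inv_inv]
    constructor
    · intro h
      exact ⟨_, h, by simp⟩
    · rintro ⟨e, he, h⟩
      rw [← h]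
      simpa using he
  classical
  simp only [Set.indicator_apply, hE, Set.mem_ofPred_eq]
  split_ifs <;> simp_all
end
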